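/- arXiv:1312.6371 — 7 statements merged into one kernel-verified Lean document; each statement's English description precedes it below -/
import Mathlib

section
/- Fix a prime number p and integers d, f ≥ 1, and let k be an algebraically closed field of characteristic zero. With A and I as follows: A is the localization of the polynomial ring over k in the 2fd² entries of d×d matrices of indeterminates X⁽⁰⁾,…,X⁽ᶠ⁻¹⁾, Y⁽⁰⁾,…,Y⁽ᶠ⁻¹⁾ at the element det(X⁽⁰⁾)⋯det(X⁽ᶠ⁻¹⁾), and I ⊆ A is the ideal generated by the entries of the matrices p·X⁽ⁱ⁾·Y⁽ⁱ⁻¹⁾ − Y⁽ⁱ⁾·X⁽ⁱ⁾ for i = 0,…,f−1 (superscripts modulo f). Then the set of minimal prime ideals of A/I is finite, and its cardinality equals the number of partitions of d. -/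
noncomputable section

variable (k : Type) [Field k] (p d f : ℕ)

/-- The polynomial ring over `k` in the `2·f·d²` entries of the matrices
`X⁽⁰⁾,…,X⁽ᶠ⁻¹⁾, Y⁽⁰⁾,…,Y⁽ᶠ⁻¹⁾`. -/
abbrev PKPoly := MvPolynomial (Fin 2 × Fin f × Fin d × Fin d) k

/-- The matrix of indeterminates `X⁽ⁱ⁾`. -/
def Xmat (i : Fin f) : Matrix (Fin d) (Fin d) (PKPoly k d f) :=
  Matrix.of fun a b => MvPolynomial.X (0, i, a, b)

/-- The matrix of indeterminates `Y⁽ⁱ⁾`. -/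
def Ymat (i : Fin f) : Matrix (Fin d) (Fin d) (PKPoly k d f) :=
  Matrix.of fun a b => MvPolynomial.X (1, i, a, b)

/-- The element `det(X⁽⁰⁾)·det(X⁽¹⁾)⋯det(X⁽ᶠ⁻¹⁾)`. -/
def detProd : PKPoly k d f := ∏ i : Fin f, (Xmat k d f i).det

/-- The localization `A` of the polynomial ring at `det(X⁽⁰⁾)⋯det(X⁽ᶠ⁻¹⁾)`. -/
abbrev PKLoc := Localization.Away (detProd k d f)

def XmatL (i : Fin f) : Matrix (Fin d) (Fin d) (PKLoc k d f) :=
  (Xmat k d f i).map (algebraMap (PKPoly k d f) (PKLoc k d f))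

def YmatL (i : Fin f) : Matrix (Fin d) (Fin d) (PKLoc k d f) :=
  (Ymat k d f i).map (algebraMap (PKPoly k d f) (PKLoc k d f))

/-- The ideal `I ⊆ A` generated by the `f·d²` entries of the matrices
`p·X⁽ⁱ⁾·Y⁽ⁱ⁻¹⁾ − Y⁽ⁱ⁾·X⁽ⁱ⁾`, `i = 0,…,f−1` (superscripts mod `f`). -/
def relIdeal [NeZero f] : Ideal (PKLoc k d f) :=
  Ideal.span {x | ∃ (i : Fin f) (a b : Fin d),
    x = ((p : PKLoc k d f) • (XmatL k d f i * YmatL k d f (i - 1)) -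
          YmatL k d f i * XmatL k d f i) a b}

namespace PhiN

open Matrix Polynomial

section Cells

variable {d : ℕ}

/-- The cells of the Young diagram of a partition. -/
abbrev Cell (l : Nat.Partition d) : Type := Σ j : l.parts.ToType, Fin j.1

lemma card_cell (l : Nat.Partition d) : Fintype.card (Cell l) = d := by
  have h := congrArg Multiset.sum (Multiset.map_univ_coe l.parts)
  rw [l.parts_sum] at h
  rw [Fintype.card_sigma]
  simp only [Fintype.card_fin]
  exact h

/-- An enumeration of the cells of the Young diagram of a partition of `d` by `Fin d`. -/
noncomputable def cellEquiv (l : Nat.Partition d) : Cell l ≃ Fin d :=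
  Fintype.equivFinOfCardEq (card_cell l)

/-- The row of the `a`-th cell. -/
noncomputable def row (l : Nat.Partition d) (a : Fin d) : ℕ :=
  Fintype.equivFin _ ((cellEquiv l).symm a).1

/-- The position of the `a`-th cell in its row. -/
noncomputable def pos (l : Nat.Partition d) (a : Fin d) : ℕ := ((cellEquiv l).symm a).2

lemma eq_of_row_pos (l : Nat.Partition d) {a b : Fin d} (h : row l a = row l b)
    (h' : pos l a = pos l b) : a = b := by
  apply (cellEquiv l).symm.injective
  have h1 : ((cellEquiv l).symm a).1 = ((cellEquiv l).symm b).1 :=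
    (Fintype.equivFin _).injective (Fin.ext h)
  unfold pos at h'
  revert h1 h'
  generalize (cellEquiv l).symm a = x
  generalize (cellEquiv l).symm b = y
  rcases x with ⟨i, s⟩
  rcases y with ⟨j, t⟩
  rintro h1 rfl
  simp only at h1
  congr
  exact Fin.ext h1

lemma exists_row_pos (l : Nat.Partition d) (b : Fin d) {s : ℕ} (hs : s ≤ pos l b) :
    ∃ a, row l a = row l b ∧ pos l a = s := by
  refine ⟨cellEquiv l ⟨((cellEquiv l).symm b).1, ⟨s, hs.trans_lt ((cellEquiv l).symm b).2.2⟩⟩,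
    ?_, ?_⟩
  · simp [row]
  · rw [pos, Equiv.symm_apply_apply]

lemma card_pos_eq (l : Nat.Partition d) (t : ℕ) :
    (Finset.univ.filter fun a => pos l a = t).card = (l.parts.filter (t < ·)).card := by
  have h1 : (Finset.univ.filter fun a => pos l a = t).card =
      (Finset.univ.filter fun c : Cell l => (c.2 : ℕ) = t).card := by
    refine Finset.card_equiv (cellEquiv l).symm fun a => ?_
    simp only [Finset.mem_filter, Finset.mem_univ, true_and]
    rfl
  have h2 : (Finset.univ.filter fun c : Cell l => (c.2 : ℕ) = t).card =
      (Finset.univ.filter fun j : l.parts.ToType => t < j.1).card := by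
    refine Finset.card_bij (fun c _ => c.1) ?_ ?_ ?_
    · rintro ⟨j, s⟩ h
      simp only [Finset.mem_filter, Finset.mem_univ, true_and] at h ⊢
      exact h ▸ s.2
    · rintro ⟨j, s⟩ h ⟨j', s'⟩ h' e
      simp only [Finset.mem_filter, Finset.mem_univ, true_and] at h h' e
      subst e
      congr
      exact Fin.ext (h.trans h'.symm)
    · intro j h
      simp only [Finset.mem_filter, Finset.mem_univ, true_and] at h
      exact ⟨⟨j, ⟨t, h⟩⟩, by simp, rfl⟩
  rw [h1, h2]
  conv_rhs => rw [← Multiset.map_univ_coe l.parts, Multiset.filter_map, Multiset.card_map]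
  rfl

/-- The number of cells in position at least `t`. -/
noncomputable def tailCard (l : Nat.Partition d) (t : ℕ) : ℕ :=
  (Finset.univ.filter fun a => t ≤ pos l a).card

lemma tailCard_succ (l : Nat.Partition d) (t : ℕ) :
    tailCard l t = (l.parts.filter (t < ·)).card + tailCard l (t + 1) := by
  rw [← card_pos_eq, tailCard, tailCard, ← Finset.card_union_of_disjoint]
  · congr 1
    ext a
    simp only [Finset.mem_filter, Finset.mem_univ, true_and, Finset.mem_union]
    omega
  · refine Finset.disjoint_filter.2 fun a _ h => ?_
    omega

lemma eq_of_tailCard {l m : Nat.Partition d} (h : ∀ t, tailCard l t = tailCard m t) : l = m := by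
  have h1 (t : ℕ) : (l.parts.filter (t < ·)).card = (m.parts.filter (t < ·)).card := by
    have h2 := tailCard_succ l t
    have h3 := tailCard_succ m t
    rw [h t, h (t + 1)] at h2
    omega
  have h2 (s : Multiset ℕ) (n : ℕ) : (s.filter (n < ·)).card =
      s.count (n + 1) + (s.filter (n + 1 < ·)).card := by
    rw [Multiset.count_eq_card_filter_eq, ← Multiset.card_add, Multiset.filter_add_filter,
      Multiset.card_add]
    rw [Multiset.filter_eq_nil (p := fun a => n + 1 = a ∧ n + 1 < a) |>.2, Multiset.card_zero,
      add_zero]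
    · congr 1
      refine Multiset.filter_congr fun x _ => ?_
      omega
    · intro a _
      omega
  ext n
  rcases n with _ | n
  · rw [Multiset.count_eq_zero_of_notMem fun h => (l.parts_pos h).ne rfl,
      Multiset.count_eq_zero_of_notMem fun h => (m.parts_pos h).ne rfl]
  · have := h2 l.parts n
    have := h2 m.parts n
    have := h1 n
    have := h1 (n + 1)
    omega

/-- The nilpotent Jordan matrix whose block sizes are the parts of a partition. -/
noncomputable def jordan (l : Nat.Partition d) (R : Type*) [Zero R] [One R] :
    Matrix (Fin d) (Fin d) R :=
  Matrix.of fun a b => if row l a = row l b ∧ pos l b = pos l a + 1 then 1 else 0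

lemma jordan_apply (l : Nat.Partition d) {R : Type*} [Zero R] [One R] (a b : Fin d) :
    jordan l R a b = if row l a = row l b ∧ pos l b = pos l a + 1 then 1 else 0 := rfl

lemma jordan_map (l : Nat.Partition d) {R S : Type*} [Semiring R] [Semiring S] (φ : R →+* S) :
    (jordan l R).map φ = jordan l S := by
  ext a b
  simp [jordan_apply, apply_ite φ]

lemma jordan_pow (l : Nat.Partition d) {R : Type*} [Semiring R] (t : ℕ) :
    jordan l R ^ t = Matrix.of fun a b =>
      if row l a = row l b ∧ pos l b = pos l a + t then 1 else 0 := by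
  induction t with
  | zero =>
    ext a b
    simp only [pow_zero, Matrix.one_apply, Matrix.of_apply, add_zero]
    refine if_congr ⟨fun h => by simp [h], fun h => eq_of_row_pos l h.1 h.2.symm⟩ rfl rfl
  | succ t ih =>
    ext a b
    rw [pow_succ, ih, Matrix.mul_apply]
    simp only [Matrix.of_apply, jordan_apply, ← ite_and, mul_ite, mul_one, mul_zero]
    split_ifs with h
    · obtain ⟨c, hc, hc'⟩ := exists_row_pos l b (s := pos l a + t) (by omega)
      rw [Finset.sum_eq_single c]
      · rw [if_pos ⟨⟨hc, by omega⟩, by omega, by omega⟩]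
      · intro x _ hx
        rw [if_neg]
        rintro ⟨⟨h1, h2⟩, h3, h4⟩
        exact hx (eq_of_row_pos l (by omega) (by omega))
      · simp
    · refine Finset.sum_eq_zero fun c _ => if_neg ?_
      rintro ⟨⟨h1, h2⟩, h3, h4⟩
      exact h ⟨by omega, by omega⟩

/-- A minor of a power of the Jordan matrix which is the identity matrix. -/
lemma exists_submatrix_jordan_pow (l : Nat.Partition d) (t : ℕ) :
    ∃ r : {b // t ≤ pos l b} → Fin d, ∀ (R : Type) [Semiring R],
      (jordan l R ^ t).submatrix r (fun b : {b // t ≤ pos l b} => b.1) = 1 := by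
  choose r hr hr' using fun b : {b // t ≤ pos l b} =>
    exists_row_pos l b.1 (s := pos l b.1 - t) (by omega)
  refine ⟨r, fun R _ => ?_⟩
  ext a b
  simp only [jordan_pow, Matrix.submatrix_apply, Matrix.of_apply, Matrix.one_apply]
  have ha := a.2
  have hb := b.2
  refine if_congr ⟨fun h => Subtype.ext (eq_of_row_pos l ?_ ?_), ?_⟩ rfl rfl
  · rw [← hr, h.1]
  · rw [h.2, hr']
    omega
  · rintro rfl
    exact ⟨hr a, by rw [hr']; omega⟩

/-- The diagonal matrix with entries `p ^ pos`, which satisfies `p • D * J = J * D`. -/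
noncomputable def shiftDiag (l : Nat.Partition d) (p : ℕ) (R : Type*) [Semiring R] :
    Matrix (Fin d) (Fin d) R :=
  Matrix.diagonal fun a => (p : R) ^ pos l a

lemma shiftDiag_mul_jordan (l : Nat.Partition d) (p : ℕ) (R : Type*) [CommRing R] :
    (p : R) • (shiftDiag l p R * jordan l R) = jordan l R * shiftDiag l p R := by
  ext a b
  simp only [shiftDiag, Matrix.smul_apply, Matrix.diagonal_mul, Matrix.mul_diagonal, jordan_apply,
    smul_eq_mul]
  split_ifs with h
  · rw [h.2, pow_succ]
    ring
  · simp

lemma isUnit_det_shiftDiag (l : Nat.Partition d) {p : ℕ} (hp : p ≠ 0) (F : Type*) [Field F]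
    [CharZero F] : IsUnit (shiftDiag l p F).det := by
  rw [isUnit_iff_ne_zero, shiftDiag, Matrix.det_diagonal, Finset.prod_ne_zero_iff]
  intro a _
  exact pow_ne_zero _ (Nat.cast_ne_zero.2 hp)

end Cells

section JordanForm

lemma exists_basis_quotient_X_pow (F : Type*) [Field F] (k : ℕ) :
    ∃ b : Module.Basis (Fin k) F (F[X] ⧸ (Submodule.span F[X] {(X : F[X]) ^ k})),
      (∀ s : Fin k, (s : ℕ) = 0 → (X : F[X]) • b s = 0) ∧
      ∀ s t : Fin k, (t : ℕ) = s + 1 → (X : F[X]) • b t = b s := by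
  have hm : ((X : F[X]) ^ k).Monic := monic_X_pow k
  let P := AdjoinRoot.powerBasis' hm
  have hdim : P.dim = k := natDegree_X_pow k
  let b : Module.Basis (Fin k) F (AdjoinRoot ((X : F[X]) ^ k)) :=
    P.basis.reindex ((finCongr hdim).trans Fin.revPerm)
  have hb (s : Fin k) : b s = AdjoinRoot.mk _ (X ^ (k - 1 - (s : ℕ))) := by
    simp only [b, Module.Basis.reindex_apply, PowerBasis.basis_eq_pow]
    rw [AdjoinRoot.powerBasis'_gen, map_pow, AdjoinRoot.mk_X]
    congr 1
    simp only [Equiv.symm_trans_apply, Fin.revPerm_symm, Fin.revPerm_apply, finCongr_symm,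
      finCongr_apply_coe, Fin.val_rev]
    omega
  have hX (q r : F[X]) (h : AdjoinRoot.mk (X ^ k) (X * q) = AdjoinRoot.mk (X ^ k) r) :
      (X : F[X]) • (Submodule.Quotient.mk q : F[X] ⧸ (Submodule.span F[X] {(X : F[X]) ^ k})) =
        Submodule.Quotient.mk r := h
  let b' : Module.Basis (Fin k) F (F[X] ⧸ (Submodule.span F[X] {(X : F[X]) ^ k})) := b
  have hb' (s : Fin k) : b' s = Submodule.Quotient.mk (X ^ (k - 1 - (s : ℕ))) := hb s
  refine ⟨b', fun s h => ?_, fun s t h => ?_⟩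
  · have := s.2
    rw [hb', hX _ 0, Submodule.Quotient.mk_zero]
    rw [← pow_succ', show k - 1 - (s : ℕ) + 1 = k by omega, AdjoinRoot.mk_self, map_zero]
  · have := t.2
    rw [hb', hb']
    refine hX _ _ ?_
    rw [← pow_succ', show k - 1 - (t : ℕ) + 1 = k - 1 - (s : ℕ) by omega]

lemma exists_basis_of_isNilpotent {F : Type*} [Field F] {d : ℕ} (N : Matrix (Fin d) (Fin d) F)
    (hN : IsNilpotent N) :
    ∃ (n : ℕ) (k : Fin n → ℕ) (B : Module.Basis (Σ i : Fin n, Fin (k i)) F (Fin d → F)),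
      (∀ i (s : Fin (k i)), (s : ℕ) = 0 → N *ᵥ B ⟨i, s⟩ = 0) ∧
      ∀ i (s t : Fin (k i)), (t : ℕ) = s + 1 → N *ᵥ B ⟨i, t⟩ = B ⟨i, s⟩ := by
  classical
  let φ : Module.End F (Fin d → F) := Matrix.toLin' N
  obtain ⟨r, hr⟩ := hN
  have hφ : φ ^ r = 0 := by
    rw [← Matrix.toLin'_pow, hr, map_zero]
  have htors : Module.IsTorsion' (Module.AEval' φ) (Submonoid.powers (X : F[X])) := by
    intro x
    refine ⟨⟨X ^ r, r, rfl⟩, ?_⟩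
    obtain ⟨y, rfl⟩ := (Module.AEval'.of φ).surjective x
    change (X : F[X]) ^ r • (Module.AEval'.of φ) y = 0
    rw [Module.AEval'.X_pow_smul_of, hφ]
    simp
  obtain ⟨n, k, ⟨e⟩⟩ :=
    Module.torsion_by_prime_power_decomposition (p := (X : F[X])) irreducible_X htors
  choose b hb hb' using fun i => exists_basis_quotient_X_pow F (k i)
  let B0 : Module.Basis (Σ i : Fin n, Fin (k i)) F
      (DirectSum (Fin n) fun i => F[X] ⧸ (Submodule.span F[X] {(X : F[X]) ^ (k i)})) :=
    DFinsupp.basis b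
  have hB0 (i s) : B0 ⟨i, s⟩ = DirectSum.lof F[X] _ _ i (b i s) := by
    refine Module.Basis.apply_eq_iff.mpr ?_
    ext ⟨j, t⟩
    change (b j).repr ((DirectSum.lof F[X] _ _ i (b i s) :
      DirectSum (Fin n) fun i => F[X] ⧸ (Submodule.span F[X] {(X : F[X]) ^ (k i)})) j) t = _
    by_cases h : i = j
    · subst h
      rw [DirectSum.lof_apply, Module.Basis.repr_self]
      change Finsupp.single s (1 : F) t =
        Finsupp.single (⟨i, s⟩ : Σ i : Fin n, Fin (k i)) (1 : F) ⟨i, t⟩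
      simp [Finsupp.single_apply]
    · rw [DirectSum.lof_eq_of, DirectSum.of_eq_of_ne _ _ _ (Ne.symm h), map_zero,
        Finsupp.single_apply, if_neg]
      · rfl
      · simp [h]
  let B : Module.Basis (Σ i : Fin n, Fin (k i)) F (Fin d → F) :=
    B0.map ((e.restrictScalars F).symm.trans (Module.AEval'.of φ).symm)
  have hB (i s) : N *ᵥ B ⟨i, s⟩ =
      (Module.AEval'.of φ).symm (e.symm (DirectSum.lof F[X] _ _ i ((X : F[X]) • b i s))) := by
    rw [map_smul, map_smul, Module.AEval'.of_symm_X_smul, ← hB0]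
    rfl
  refine ⟨n, k, B, fun i s h => ?_, fun i s t h => ?_⟩
  · rw [hB, hb i s h, map_zero, map_zero, map_zero]
  · rw [hB, hb' i s t h, ← hB0]
    rfl

end JordanForm

section JordanForm

/-- Jordan normal form of nilpotent matrices. -/
theorem exists_mul_eq_mul_jordan {F : Type*} [Field F] {d : ℕ} (N : Matrix (Fin d) (Fin d) F)
    (hN : IsNilpotent N) :
    ∃ (l : Nat.Partition d) (g : Matrix (Fin d) (Fin d) F),
      IsUnit g.det ∧ N * g = g * jordan l F := by
  classical
  obtain ⟨n, k, B, hB, hB'⟩ := exists_basis_of_isNilpotent N hN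
  have hsum : (Finset.univ.val.map k).sum = d := by
    have h := Module.finrank_eq_card_basis B
    rw [Module.finrank_fin_fun, Fintype.card_sigma] at h
    simp only [Fintype.card_fin] at h
    exact h.symm
  let l : Nat.Partition d := Nat.Partition.ofSums d _ hsum
  have hle : l.parts ≤ Finset.univ.val.map k := Multiset.filter_le (· ≠ 0) _
  have hcard (x : ℕ) : Nonempty (Fin (l.parts.count x) ↪ {i // k i = x}) := by
    apply Function.Embedding.nonempty_of_card_le
    rw [Fintype.card_fin, Fintype.card_subtype]
    refine (Multiset.count_le_of_le x hle).trans ?_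
    rw [Multiset.count_map]
    refine (Finset.card_le_card (s := Finset.univ.filter fun i => x = k i) ?_)
    intro i
    simp [eq_comm]
  let τ (j : l.parts.ToType) : Fin n := ((hcard j.1).some j.2).1
  have hτ (j : l.parts.ToType) : k (τ j) = j.1 := ((hcard j.1).some j.2).2
  have hτi : Function.Injective τ := by
    intro i j h
    have h1 : i.1 = j.1 := by rw [← hτ, h, hτ]
    rcases i with ⟨x, i⟩
    rcases j with ⟨y, j⟩
    simp only at h1
    subst h1
    congr
    exact (hcard x).some.injective (Subtype.ext h)
  let c (a : Fin d) : Σ i : Fin n, Fin (k i) :=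
    ⟨τ ((cellEquiv l).symm a).1, Fin.cast (hτ _).symm ((cellEquiv l).symm a).2⟩
  have hc1 (a b : Fin d) : (c a).1 = (c b).1 ↔ row l a = row l b := by
    simp only [c, row, hτi.eq_iff, Fin.val_inj, EmbeddingLike.apply_eq_iff_eq]
  have hc2 (a : Fin d) : ((c a).2 : ℕ) = pos l a := rfl
  have hci : Function.Injective c := fun a b h =>
    eq_of_row_pos l ((hc1 a b).1 (by rw [h])) (by rw [← hc2, ← hc2, h])
  let g : Matrix (Fin d) (Fin d) F := Matrix.of fun a b => B (c b) a
  have hg : g.col = fun b => B (c b) := rfl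
  refine ⟨l, g, ?_, ?_⟩
  · rw [← Matrix.isUnit_iff_isUnit_det, ← Matrix.linearIndependent_cols_iff_isUnit, hg]
    exact B.linearIndependent.comp c hci
  · suffices h : ∀ b, N *ᵥ B (c b) = ∑ a, jordan l F a b • B (c a) by
      ext x b
      have := congrFun (h b) x
      simp only [Finset.sum_apply, Pi.smul_apply, smul_eq_mul] at this
      rw [Matrix.mul_apply, Matrix.mul_apply]
      refine Eq.trans this (Finset.sum_congr rfl fun a _ => mul_comm _ _)
    intro b
    have hcb : c b = ⟨(c b).1, (c b).2⟩ := rfl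
    rcases Nat.eq_zero_or_pos (pos l b) with h | h
    · rw [hcb, hB _ _ ((hc2 b).trans h)]
      refine (Finset.sum_eq_zero fun a _ => ?_).symm
      rw [jordan_apply, if_neg (by omega), zero_smul]
    · obtain ⟨a, ha, ha'⟩ := exists_row_pos l b (s := pos l b - 1) (by omega)
      rw [Finset.sum_eq_single a, jordan_apply, if_pos ⟨ha, by omega⟩, one_smul]
      · have h1 := (hc1 a b).2 ha
        have h2 : ((c b).2 : ℕ) = (c a).2 + 1 := by rw [hc2, hc2]; omega
        revert h1 h2
        generalize c a = y
        generalize c b = z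
        rcases y with ⟨i, s⟩
        rcases z with ⟨j, t⟩
        rintro h1 h2
        simp only at h1
        subst h1
        exact hB' _ _ _ h2
      · intro x _ hx
        rw [jordan_apply, if_neg, zero_smul]
        rintro ⟨h1, h2⟩
        exact hx (eq_of_row_pos l (by omega) (by omega))
      · simp

end JordanForm

section Nilpotent

/-- A matrix which is conjugate to a multiple of itself by a number which is not a root of unity
is nilpotent. -/
lemma isNilpotent_of_mul_eq_smul_mul {F : Type*} [Field F] [CharZero F] {d : ℕ} {q : F}
    (hq : q ≠ 0) (hq' : ∀ n : ℕ, n ≠ 0 → q ^ n ≠ 1) {M Y : Matrix (Fin d) (Fin d) F}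
    (hM : IsUnit M.det) (h : Y * M = q • (M * Y)) : IsNilpotent Y := by
  have h1 : (q • Y).charpoly = Y.charpoly := by
    obtain ⟨u, rfl⟩ := (Matrix.isUnit_iff_isUnit_det M).2 hM
    rw [← Matrix.charpoly_units_conj u (q • Y)]
    congr 1
    rw [Matrix.mul_smul, ← h, mul_assoc, Matrix.mul_nonsing_inv _ hM, mul_one]
  have h2 : Y.charpoly.comp (C q * X) = C (q ^ d) * Y.charpoly := by
    refine Polynomial.funext fun t => ?_
    rw [← h1]
    conv_rhs => rw [h1]
    simp only [eval_comp, eval_mul, eval_C, eval_X, Matrix.eval_charpoly]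
    have h3 : Matrix.scalar (Fin d) (q * t) - q • Y = q • (Matrix.scalar (Fin d) t - Y) := by
      rw [smul_sub, Matrix.scalar_apply, Matrix.scalar_apply, ← Matrix.diagonal_smul]
      rfl
    rw [h3, Matrix.det_smul, Fintype.card_fin]
  have h4 : Y.charpoly = X ^ d := by
    ext j
    rw [coeff_X_pow]
    split_ifs with hj
    · subst hj
      have := Y.charpoly_monic.coeff_natDegree
      rwa [Matrix.charpoly_natDegree_eq_dim, Fintype.card_fin] at this
    · rcases lt_or_ge d j with h | h
      · refine coeff_eq_zero_of_natDegree_lt ?_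
        rwa [Matrix.charpoly_natDegree_eq_dim, Fintype.card_fin]
      · have h5 := congrArg (fun P => P.coeff j) h2
        simp only [comp_C_mul_X_coeff, coeff_C_mul] at h5
        by_contra h6
        have h7 := mul_right_cancel₀ h6 ((mul_comm _ _).trans h5)
        rw [← Nat.add_sub_cancel' h, pow_add] at h7
        exact hq' (d - j) (by omega)
          (mul_left_cancel₀ (pow_ne_zero j hq) (h7.symm.trans (mul_one _).symm))
  refine ⟨d, ?_⟩
  have := Y.aeval_self_charpoly
  rwa [h4, map_pow, aeval_X] at this

end Nilpotent

section Cyclic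

variable {d f : ℕ} [NeZero f]

lemma ofNat_succ_sub_one (n : ℕ) : Fin.ofNat f (n + 1) - 1 = Fin.ofNat f n := by
  rw [sub_eq_iff_eq_add]
  ext
  simp [Fin.val_add]

lemma forall_fin_of_cyclic {P : Fin f → Prop} (h0 : P (-1)) (h : ∀ i, P (i - 1) → P i) (i : Fin f) :
    P i := by
  have h1 (n : ℕ) : P (Fin.ofNat f n - 1) := by
    induction n with
    | zero => simpa using h0
    | succ n ih =>
      rw [ofNat_succ_sub_one]
      exact h _ ih
  have := h1 (i + 1)
  rw [ofNat_succ_sub_one] at this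
  simpa using this

/-- The product `X⁽ⁿ⁻¹⁾ ⋯ X⁽⁰⁾`, superscripts modulo `f`. -/
def cycProd {R : Type*} [CommRing R] (X : Fin f → Matrix (Fin d) (Fin d) R) :
    ℕ → Matrix (Fin d) (Fin d) R
  | 0 => 1
  | n + 1 => X (Fin.ofNat f n) * cycProd X n

lemma cycProd_map {R S : Type*} [CommRing R] [CommRing S] (φ : R →+* S)
    (X : Fin f → Matrix (Fin d) (Fin d) R) (n : ℕ) :
    (cycProd X n).map φ = cycProd (fun i => (X i).map φ) n := by
  induction n with
  | zero => simp [cycProd, Matrix.map_one]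
  | succ n ih => rw [cycProd, Matrix.map_mul, ih, cycProd]

lemma isUnit_det_cycProd {R : Type*} [CommRing R] {X : Fin f → Matrix (Fin d) (Fin d) R}
    (hX : ∀ i, IsUnit (X i).det) (n : ℕ) : IsUnit (cycProd X n).det := by
  induction n with
  | zero => simp [cycProd]
  | succ n ih =>
    rw [cycProd, Matrix.det_mul]
    exact (hX _).mul ih

lemma mul_cycProd {R : Type*} [CommRing R] {p : R} {X Y : Fin f → Matrix (Fin d) (Fin d) R}
    (h : ∀ i, p • (X i * Y (i - 1)) = Y i * X i) (n : ℕ) :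
    Y (Fin.ofNat f n - 1) * cycProd X n = p ^ n • (cycProd X n * Y (-1)) := by
  induction n with
  | zero => simp [cycProd]
  | succ n ih =>
    rw [ofNat_succ_sub_one, cycProd, ← mul_assoc, ← h, Matrix.smul_mul, mul_assoc, ih,
      Matrix.mul_smul, smul_smul, pow_succ', mul_assoc]

lemma mul_cycProd_self {R : Type*} [CommRing R] {p : R} {X Y : Fin f → Matrix (Fin d) (Fin d) R}
    (h : ∀ i, p • (X i * Y (i - 1)) = Y i * X i) :
    Y (-1) * cycProd X f = p ^ f • (cycProd X f * Y (-1)) := by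
  have := mul_cycProd h f
  rwa [show Fin.ofNat f f = 0 by ext; simp, zero_sub] at this

theorem exists_mul_eq_mul_jordan_of_cyclic {F : Type*} [Field F] [CharZero F] {p : ℕ}
    (hp : p.Prime) {X Y : Fin f → Matrix (Fin d) (Fin d) F} (hX : ∀ i, IsUnit (X i).det)
    (h : ∀ i, (p : F) • (X i * Y (i - 1)) = Y i * X i) :
    ∃ (l : Nat.Partition d) (g : Fin f → Matrix (Fin d) (Fin d) F),
      ∀ i, IsUnit (g i).det ∧ Y i * g i = g i * jordan l F := by
  have hnil : IsNilpotent (Y (-1)) := by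
    refine isNilpotent_of_mul_eq_smul_mul (q := (p : F) ^ f)
      (pow_ne_zero _ (Nat.cast_ne_zero.2 hp.ne_zero)) (fun n hn => ?_)
      (isUnit_det_cycProd hX f) (mul_cycProd_self h)
    rw [← pow_mul]
    exact_mod_cast (Nat.one_lt_pow (mul_ne_zero (NeZero.ne f) hn) hp.one_lt).ne'
  obtain ⟨l, g, hg, hg'⟩ := exists_mul_eq_mul_jordan _ hnil
  refine ⟨l, ?_⟩
  suffices h1 : ∀ i, ∃ g : Matrix (Fin d) (Fin d) F, IsUnit g.det ∧ Y i * g = g * jordan l F by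
    choose g hg using h1
    exact ⟨g, hg⟩
  refine forall_fin_of_cyclic ⟨g, hg, hg'⟩ ?_
  rintro i ⟨g, hg, hg'⟩
  have hD := isUnit_det_shiftDiag l hp.ne_zero F
  have hDJ := shiftDiag_mul_jordan l p F
  generalize shiftDiag l p F = D at hD hDJ
  refine ⟨X i * g * D⁻¹, ?_, ?_⟩
  · rw [Matrix.det_mul, Matrix.det_mul]
    exact ((hX i).mul hg).mul (Matrix.isUnit_nonsing_inv_det _ hD)
  · have h2 : (p : F) • (jordan l F * D⁻¹) = D⁻¹ * jordan l F := by
      calc (p : F) • (jordan l F * D⁻¹) = (p : F) • (D⁻¹ * D * jordan l F * D⁻¹) := by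
            rw [Matrix.nonsing_inv_mul _ hD, one_mul]
        _ = D⁻¹ * ((p : F) • (D * jordan l F)) * D⁻¹ := by
            simp only [Matrix.mul_smul, Matrix.smul_mul, mul_assoc]
        _ = D⁻¹ * jordan l F := by
            rw [hDJ, mul_assoc, mul_assoc, Matrix.mul_nonsing_inv _ hD, mul_one]
    calc Y i * (X i * g * D⁻¹) = (Y i * X i) * g * D⁻¹ := by simp only [mul_assoc]
      _ = X i * (Y (i - 1) * g) * ((p : F) • D⁻¹) := by
          rw [← h]; simp only [Matrix.mul_smul, Matrix.smul_mul, mul_assoc]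
      _ = X i * g * ((p : F) • (jordan l F * D⁻¹)) := by
          rw [hg']; simp only [Matrix.mul_smul, mul_assoc]
      _ = X i * g * D⁻¹ * jordan l F := by rw [h2]; simp only [mul_assoc]

end Cyclic

section Sylvester

open scoped Kronecker

lemma exists_mul_mul_self {F m : Type*} [Field F] [Fintype m] [DecidableEq m] (T : Matrix m m F) :
    ∃ G : Matrix m m F, T * G * T = T := by
  let t := Matrix.toLin' T
  obtain ⟨s, hs⟩ := t.rangeRestrict.exists_rightInverse_of_surjective t.range_rangeRestrict
  obtain ⟨s', hs'⟩ := LinearMap.exists_extend s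
  refine ⟨LinearMap.toMatrix' s', Matrix.toLin'.injective (LinearMap.ext fun x => ?_)⟩
  have h1 := congrArg Subtype.val (LinearMap.congr_fun hs (t.rangeRestrict x))
  have h2 := LinearMap.congr_fun hs' (t.rangeRestrict x)
  simp only [LinearMap.comp_apply, Submodule.subtype_apply, LinearMap.id_apply] at h1 h2
  rw [Matrix.toLin'_mul, Matrix.toLin'_mul, Matrix.toLin'_toMatrix']
  simp only [LinearMap.comp_apply]
  change t (s' (t x)) = t x
  rw [LinearMap.codRestrict_apply] at h2
  rw [show s' (t x) = s (t.rangeRestrict x) from h2]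
  exact h1

/-- The space of solutions `Z` of `c • (Z * J) = J * Z` is the image of a projection defined over
the ground field. -/
lemma exists_projection {F : Type} [Field F] {d : ℕ} (J : Matrix (Fin d) (Fin d) F) (c : F) :
    ∃ π : ∀ (R : Type) [CommRing R] [Algebra F R],
        Matrix (Fin d) (Fin d) R → Matrix (Fin d) (Fin d) R,
      (∀ (R : Type) [CommRing R] [Algebra F R] (Z : Matrix (Fin d) (Fin d) R),
        algebraMap F R c • (π R Z * J.map (algebraMap F R)) = J.map (algebraMap F R) * π R Z) ∧
      (∀ (R : Type) [CommRing R] [Algebra F R] (Z : Matrix (Fin d) (Fin d) R),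
        algebraMap F R c • (Z * J.map (algebraMap F R)) = J.map (algebraMap F R) * Z →
          π R Z = Z) ∧
      ∀ (R S : Type) [CommRing R] [Algebra F R] [CommRing S] [Algebra F S] (φ : R →ₐ[F] S)
        (Z : Matrix (Fin d) (Fin d) R), (π R Z).map φ = π S (Z.map φ) := by
  let T : Matrix (Fin d × Fin d) (Fin d × Fin d) F := c • (Jᵀ ⊗ₖ 1) - 1 ⊗ₖ J
  have hT (R : Type) [CommRing R] [Algebra F R] (Z : Matrix (Fin d) (Fin d) R) :
      T.map (algebraMap F R) *ᵥ vec Z =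
        vec (algebraMap F R c • (Z * J.map (algebraMap F R)) - J.map (algebraMap F R) * Z) := by
    have h1 : T.map (algebraMap F R) = algebraMap F R c • ((J.map (algebraMap F R))ᵀ ⊗ₖ 1) -
        1 ⊗ₖ (J.map (algebraMap F R)) := by
      ext ⟨a, b⟩ ⟨a', b'⟩
      simp only [T, Matrix.map_apply, Matrix.sub_apply, Matrix.smul_apply, Matrix.kronecker_apply,
        Matrix.transpose_apply, Matrix.one_apply, smul_eq_mul, map_sub, map_mul,
        apply_ite (algebraMap F R), map_one, map_zero]
    rw [h1, Matrix.sub_mulVec, Matrix.smul_mulVec, Matrix.kronecker_mulVec_vec,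
      Matrix.kronecker_mulVec_vec, vec_sub, vec_smul]
    simp
  obtain ⟨G, hG⟩ := exists_mul_mul_self T
  have hGR (R : Type) [CommRing R] [Algebra F R] : T.map (algebraMap F R) *
      G.map (algebraMap F R) * T.map (algebraMap F R) = T.map (algebraMap F R) := by
    rw [← Matrix.map_mul, ← Matrix.map_mul, hG]
  let π (R : Type) [CommRing R] [Algebra F R] (Z : Matrix (Fin d) (Fin d) R) :
      Matrix (Fin d) (Fin d) R := Matrix.of fun a b =>
    (vec Z - G.map (algebraMap F R) *ᵥ (T.map (algebraMap F R) *ᵥ vec Z)) (b, a)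
  have hπ (R : Type) [CommRing R] [Algebra F R] (Z : Matrix (Fin d) (Fin d) R) : vec (π R Z) =
    vec Z - G.map (algebraMap F R) *ᵥ (T.map (algebraMap F R) *ᵥ vec Z) := rfl
  refine ⟨π, fun R _ _ Z => ?_, fun R _ _ Z hZ => ?_, fun R S _ _ _ _ φ Z => ?_⟩
  · rw [← sub_eq_zero, ← vec_eq_zero_iff, ← hT, hπ, Matrix.mulVec_sub, Matrix.mulVec_mulVec,
      Matrix.mulVec_mulVec, hGR, sub_self]
  · rw [← vec_inj, hπ, hT, hZ, sub_self, vec_zero, Matrix.mulVec_zero, sub_zero]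
  · rw [← vec_inj, hπ, vec_map, hπ, vec_map]
    have h1 (A : Matrix (Fin d × Fin d) (Fin d × Fin d) F) (v : Fin d × Fin d → R) :
        φ ∘ (A.map (algebraMap F R) *ᵥ v) = A.map (algebraMap F S) *ᵥ (φ ∘ v) := by
      ext x
      simp [Matrix.mulVec, dotProduct]
    rw [← h1, ← h1]
    ext x
    simp

end Sylvester

section Points

variable {k : Type} [Field k] {d f : ℕ} {R : Type} [CommRing R] [Algebra k R]

lemma exists_polyHom (X Y : Fin f → Matrix (Fin d) (Fin d) R) :
    ∃ φ : PKPoly k d f →ₐ[k] R,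
      (∀ i, (Xmat k d f i).map φ = X i) ∧ ∀ i, (Ymat k d f i).map φ = Y i := by
  refine ⟨MvPolynomial.aeval fun x => if x.1 = 0 then X x.2.1 x.2.2.1 x.2.2.2 else
    Y x.2.1 x.2.2.1 x.2.2.2, fun i => ?_, fun i => ?_⟩
  · ext a b
    simp [Xmat]
  · ext a b
    simp [Ymat]

lemma polyHom_detProd (φ : PKPoly k d f →ₐ[k] R) :
    φ (detProd k d f) = ∏ i, ((Xmat k d f i).map φ).det := by
  unfold detProd
  rw [map_prod]
  exact Finset.prod_congr rfl fun i _ => AlgHom.map_det _ _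

lemma exists_locHom (X Y : Fin f → Matrix (Fin d) (Fin d) R) (hX : ∀ i, IsUnit (X i).det) :
    ∃ φ : PKLoc k d f →ₐ[k] R,
      (∀ i, (XmatL k d f i).map φ = X i) ∧ ∀ i, (YmatL k d f i).map φ = Y i := by
  obtain ⟨φ, hφX, hφY⟩ := exists_polyHom (k := k) X Y
  have h : IsUnit (φ (detProd k d f)) := by
    rw [polyHom_detProd]
    simp only [hφX]
    exact IsUnit.prod_univ_iff.2 hX
  have h' : ∀ y : Submonoid.powers (detProd k d f), IsUnit (φ y) := by
    rintro ⟨_, n, rfl⟩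
    simpa using h.pow n
  refine ⟨IsLocalization.liftAlgHom h', fun i => ?_, fun i => ?_⟩
  · rw [← hφX]
    ext a b
    simp [XmatL]
  · rw [← hφY]
    ext a b
    simp [YmatL]

lemma locHom_ext {φ ψ : PKLoc k d f →ₐ[k] R}
    (hX : ∀ i, (XmatL k d f i).map φ = (XmatL k d f i).map ψ)
    (hY : ∀ i, (YmatL k d f i).map φ = (YmatL k d f i).map ψ) : φ = ψ := by
  refine IsLocalization.algHom_ext (Submonoid.powers (detProd k d f)) ?_
  refine MvPolynomial.algHom_ext fun ⟨s, i, a, b⟩ => ?_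
  fin_cases s
  · exact congrFun (congrFun (hX i) a) b
  · exact congrFun (congrFun (hY i) a) b

lemma isUnit_det_XmatL (i : Fin f) : IsUnit (XmatL k d f i).det := by
  have h : IsUnit (∏ i, algebraMap (PKPoly k d f) (PKLoc k d f) (Xmat k d f i).det) := by
    rw [← map_prod]
    exact IsLocalization.Away.algebraMap_isUnit (detProd k d f)
  have h1 := IsUnit.prod_univ_iff.1 h i
  rwa [RingHom.map_det] at h1

lemma isUnit_det_map_XmatL (φ : PKLoc k d f →ₐ[k] R) (i : Fin f) :
    IsUnit ((XmatL k d f i).map φ).det := by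
  have h := (isUnit_det_XmatL (k := k) (d := d) i).map φ
  rwa [AlgHom.map_det] at h

lemma relIdeal_le_ker_iff [NeZero f] (p : ℕ) (φ : PKLoc k d f →ₐ[k] R) :
    relIdeal k p d f ≤ RingHom.ker φ ↔ ∀ i, (p : R) • ((XmatL k d f i).map φ *
      (YmatL k d f (i - 1)).map φ) = (YmatL k d f i).map φ * (XmatL k d f i).map φ := by
  have h (i : Fin f) (a b : Fin d) : φ (((p : PKLoc k d f) • (XmatL k d f i * YmatL k d f (i - 1)) -
          YmatL k d f i * XmatL k d f i) a b) = ((p : R) • ((XmatL k d f i).map φ *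
      (YmatL k d f (i - 1)).map φ) - (YmatL k d f i).map φ * (XmatL k d f i).map φ) a b := by
    simp [Matrix.mul_apply]
  rw [relIdeal, Ideal.span_le]
  constructor
  · intro h1 i
    rw [← sub_eq_zero]
    ext a b
    rw [← h]
    exact h1 ⟨i, a, b, rfl⟩
  · rintro h1 _ ⟨i, a, b, rfl⟩
    rw [SetLike.mem_coe, RingHom.mem_ker, h, h1, sub_self, Matrix.zero_apply]

end Points

section Component

lemma mul_right_cancel_of_isUnit_det {R : Type*} [CommRing R] {d : ℕ}
    {A B g : Matrix (Fin d) (Fin d) R} (hg : IsUnit g.det) (h : A * g = B * g) : A = B := by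
  have h1 := congrArg (· * g⁻¹) h
  simpa only [Matrix.mul_assoc, Matrix.mul_nonsing_inv g hg, Matrix.mul_one] using h1

variable {k : Type} [Field k] {d f : ℕ}

/-- The universal family of pairs whose second member is conjugate to a given Jordan matrix cuts
out a prime ideal. -/
lemma exists_component [CharZero k] [NeZero f] {p : ℕ} (hp : p ≠ 0) (l : Nat.Partition d) :
    ∃ P : Ideal (PKLoc k d f), P.IsPrime ∧ relIdeal k p d f ≤ P ∧
      (∃ (L : Type) (_ : CommRing L) (_ : IsDomain L) (_ : Algebra k L) (φ : PKLoc k d f →ₐ[k] L)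
        (g : Fin f → Matrix (Fin d) (Fin d) L), RingHom.ker φ = P ∧
        ∀ i, IsUnit (g i).det ∧ (YmatL k d f i).map φ * g i = g i * jordan l L) ∧
      ∀ (F : Type) [Field F] [Algebra k F] (ψ : PKLoc k d f →ₐ[k] F)
        (g : Fin f → Matrix (Fin d) (Fin d) F), relIdeal k p d f ≤ RingHom.ker ψ →
        (∀ i, IsUnit (g i).det ∧ (YmatL k d f i).map ψ * g i = g i * jordan l F) →
        P ≤ RingHom.ker ψ := by
  obtain ⟨π, hπ, hπ', hπm⟩ := exists_projection (jordan l k) (p : k)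
  simp only [map_natCast, jordan_map] at hπ hπ'
  let h : PKPoly k d f := (∏ i, (Xmat k d f i).det) * ∏ i, (π _ (Ymat k d f i)).det
  have hmap {R : Type} [CommRing R] [Algebra k R] (θ : PKPoly k d f →ₐ[k] R) :
      θ h = (∏ i, ((Xmat k d f i).map θ).det) * ∏ i, (π R ((Ymat k d f i).map θ)).det := by
    simp only [h, map_mul, map_prod, ← hπm]
    congr 1 <;> exact Finset.prod_congr rfl fun i _ => AlgHom.map_det _ _
  have hh : h ≠ 0 := by
    obtain ⟨θ, hX, hY⟩ := exists_polyHom (k := k) (R := k) (d := d) (f := f) (fun _ => 1)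
      (fun _ => shiftDiag l p k)
    intro h0
    have h1 := hmap θ
    simp only [hX, hY, hπ' k _ (shiftDiag_mul_jordan l p k), h0, map_zero, Matrix.det_one,
      Finset.prod_const_one, one_mul] at h1
    have h2 := isUnit_det_shiftDiag l hp k
    exact Finset.prod_ne_zero_iff.2 (fun _ _ => h2.ne_zero) h1.symm
  let L := Localization.Away h
  have : IsDomain L := IsLocalization.isDomain_of_le_nonZeroDivisors L
    (powers_le_nonZeroDivisors_of_noZeroDivisors hh)
  let ι : PKPoly k d f →ₐ[k] L := IsScalarTower.toAlgHom k (PKPoly k d f) L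
  let G (i : Fin f) : Matrix (Fin d) (Fin d) L := (Xmat k d f i).map ι
  let Z (i : Fin f) : Matrix (Fin d) (Fin d) L := π L ((Ymat k d f i).map ι)
  have hu : IsUnit ((∏ i, (G i).det) * ∏ i, (Z i).det) := by
    rw [← hmap]
    exact IsLocalization.Away.algebraMap_isUnit h
  have hG (i : Fin f) : IsUnit (G i).det :=
    IsUnit.prod_univ_iff.1 (isUnit_of_mul_isUnit_left hu) i
  have hZ (i : Fin f) : IsUnit (Z i).det :=
    IsUnit.prod_univ_iff.1 (isUnit_of_mul_isUnit_right hu) i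
  have hGi (i : Fin f) : (G i)⁻¹ * G i = 1 := Matrix.nonsing_inv_mul _ (hG i)
  obtain ⟨φ, hφX, hφY⟩ := exists_locHom (k := k) (fun i => G i * Z i * (G (i - 1))⁻¹)
    (fun i => G i * jordan l L * (G i)⁻¹) (fun i => by
      rw [Matrix.det_mul, Matrix.det_mul]
      exact ((hG i).mul (hZ i)).mul (Matrix.isUnit_nonsing_inv_det _ (hG _)))
  have hφX' (i : Fin f) : (XmatL k d f i).map φ * G (i - 1) = G i * Z i := by
    rw [hφX, Matrix.mul_assoc, hGi, Matrix.mul_one]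
  have hφY' (i : Fin f) : (YmatL k d f i).map φ * G i = G i * jordan l L := by
    rw [hφY, Matrix.mul_assoc, hGi, Matrix.mul_one]
  refine ⟨RingHom.ker φ, RingHom.ker_isPrime _, (relIdeal_le_ker_iff p φ).2 fun i => ?_,
    ⟨L, inferInstance, inferInstance, inferInstance, φ, G, rfl, fun i => ⟨hG i, hφY' i⟩⟩,
    fun F _ _ ψ g hψ hg => ?_⟩
  · refine mul_right_cancel_of_isUnit_det (hG (i - 1)) ?_
    rw [Matrix.smul_mul, Matrix.mul_assoc, hφY', ← Matrix.mul_assoc, hφX', Matrix.mul_assoc,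
      ← Matrix.mul_smul, hπ, ← Matrix.mul_assoc, ← hφY', Matrix.mul_assoc, ← hφX',
      Matrix.mul_assoc]
  · have hgi (i : Fin f) : (g i)⁻¹ * g i = 1 := Matrix.nonsing_inv_mul _ (hg i).1
    have hgi' (i : Fin f) : g i * (g i)⁻¹ = 1 := Matrix.mul_nonsing_inv _ (hg i).1
    let z (i : Fin f) : Matrix (Fin d) (Fin d) F := (g i)⁻¹ * (XmatL k d f i).map ψ * g (i - 1)
    have hgz (i : Fin f) : g i * z i = (XmatL k d f i).map ψ * g (i - 1) := by
      simp only [z]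
      rw [Matrix.mul_assoc, ← Matrix.mul_assoc, hgi', Matrix.one_mul]
    have hz (i : Fin f) : π F (z i) = z i := by
      refine hπ' F _ ?_
      have h1 := (relIdeal_le_ker_iff p ψ).1 hψ i
      have h2 : g i * ((p : F) • (z i * jordan l F)) = g i * (jordan l F * z i) := by
        rw [Matrix.mul_smul, ← Matrix.mul_assoc, hgz, Matrix.mul_assoc, ← (hg _).2,
          ← Matrix.mul_assoc, ← Matrix.smul_mul, h1, ← Matrix.mul_assoc, ← (hg _).2,
          Matrix.mul_assoc _ (g i), hgz, Matrix.mul_assoc]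
      have h3 := congrArg ((g i)⁻¹ * ·) h2
      simpa only [← Matrix.mul_assoc, hgi, Matrix.one_mul, Matrix.mul_smul] using h3
    have hzu (i : Fin f) : IsUnit (z i).det := by
      simp only [z, Matrix.det_mul]
      exact ((Matrix.isUnit_nonsing_inv_det _ (hg i).1).mul (isUnit_det_map_XmatL ψ i)).mul
        (hg _).1
    obtain ⟨θ, hθX, hθY⟩ := exists_polyHom (k := k) g z
    have hθ : IsUnit (θ h) := by
      rw [hmap]
      simp only [hθX, hθY, hz]
      exact (IsUnit.prod_univ_iff.2 fun i => (hg i).1).mul (IsUnit.prod_univ_iff.2 hzu)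
    have hθ' : ∀ y : Submonoid.powers h, IsUnit (θ y) := by
      rintro ⟨_, n, rfl⟩
      simpa using hθ.pow n
    let Θ : L →ₐ[k] F := IsLocalization.liftAlgHom hθ'
    have hΘ (x : PKPoly k d f) : Θ (ι x) = θ x := by simp [Θ, ι]
    have hΘG (i : Fin f) : (G i).map Θ = g i := by
      rw [← hθX]
      ext a b
      simp [G, hΘ]
    have hΘZ (i : Fin f) : (Z i).map Θ = z i := by
      rw [← hz, hπm, ← hθY]
      congr 1
      ext a b
      simp [hΘ]
    have hΘX (i : Fin f) := congrArg (fun M => M.map Θ) (hφX' i)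
    have hΘY (i : Fin f) := congrArg (fun M => M.map Θ) (hφY' i)
    simp only [Matrix.map_mul, hΘG, hΘZ] at hΘX hΘY
    have hcomp : ψ = Θ.comp φ := by
      refine locHom_ext (fun i => ?_) (fun i => ?_)
      · refine mul_right_cancel_of_isUnit_det (hg (i - 1)).1 ?_
        rw [← hgz, ← hΘX, Matrix.map_map]
        rfl
      · refine mul_right_cancel_of_isUnit_det (hg i).1 ?_
        have h1 := jordan_map l (Θ : L →+* F)
        rw [(hg i).2, ← h1]
        refine (hΘY i).symm.trans ?_
        rw [Matrix.map_map]
        rfl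
    intro x hx
    rw [RingHom.mem_ker] at hx ⊢
    rw [hcomp, AlgHom.comp_apply, hx, map_zero]

end Component

section Rank

variable {d : ℕ} {F : Type} [Field F]

lemma rank_pow_le (l : Nat.Partition d) {M : Matrix (Fin d) (Fin d) F}
    (hM : ∀ a b, M a b ≠ 0 → pos l b = pos l a + 1) (t : ℕ) : (M ^ t).rank ≤ tailCard l t := by
  classical
  have h (t : ℕ) (a b : Fin d) : (M ^ t) a b ≠ 0 → pos l b = pos l a + t := by
    induction t generalizing b with
    | zero =>
      intro h1
      rw [pow_zero, Matrix.one_apply] at h1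
      have h2 : a = b := by
        by_contra h2
        exact h1 (if_neg h2)
      rw [h2, add_zero]
    | succ t ih =>
      intro h1
      rw [pow_succ, Matrix.mul_apply] at h1
      obtain ⟨c, -, hc⟩ := Finset.exists_ne_zero_of_sum_ne_zero h1
      have h2 := ih c (left_ne_zero_of_mul hc)
      have h3 := hM c b (right_ne_zero_of_mul hc)
      omega
  have h1 : M ^ t = M ^ t * Matrix.diagonal fun b => if t ≤ pos l b then 1 else 0 := by
    ext a b
    rw [Matrix.mul_diagonal]
    split_ifs with hb
    · rw [mul_one]
    · rw [mul_zero]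
      by_contra h2
      have h3 := h t a b h2
      omega
  rw [h1]
  refine (Matrix.rank_mul_le_right _ _).trans ?_
  rw [Matrix.rank_diagonal, Fintype.card_subtype, tailCard]
  simp

lemma card_le_rank_of_submatrix {ι : Type} [Fintype ι] [DecidableEq ι]
    (A : Matrix (Fin d) (Fin d) F) (r c : ι → Fin d) (h : (A.submatrix r c).det ≠ 0) :
    Fintype.card ι ≤ A.rank := by
  rw [← Matrix.rank_of_det_ne_zero h, ← Matrix.eRank_toNat_eq_rank, ← Matrix.eRank_toNat_eq_rank]
  refine ENat.toNat_le_toNat (Matrix.eRank_submatrix_le _ _ _) ?_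
  exact ne_top_of_le_ne_top (ENat.card_lt_top.2 inferInstance).ne A.eRank_le_card_width

lemma tailCard_eq_card (l : Nat.Partition d) (t : ℕ) :
    tailCard l t = Fintype.card {b // t ≤ pos l b} := by
  rw [Fintype.card_subtype, tailCard]

lemma rank_jordan_pow (l : Nat.Partition d) (t : ℕ) : (jordan l F ^ t).rank = tailCard l t := by
  refine le_antisymm (rank_pow_le l (fun a b h => ?_) t) ?_
  · rw [jordan_apply] at h
    by_contra h1
    exact h (if_neg fun h2 => h1 h2.2)
  · obtain ⟨r, hr⟩ := exists_submatrix_jordan_pow l t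
    rw [tailCard_eq_card]
    refine card_le_rank_of_submatrix _ r (fun b => b.1) ?_
    rw [hr, Matrix.det_one]
    exact one_ne_zero

lemma rank_pow_of_mul_eq {g Y J : Matrix (Fin d) (Fin d) F}
    (hg : IsUnit g.det) (h : Y * g = g * J) (t : ℕ) : (Y ^ t).rank = (J ^ t).rank := by
  have h1 : Y ^ t * g = g * J ^ t := by
    have h2 : SemiconjBy g J Y := h.symm
    exact (h2.pow_right t).eq.symm
  rw [← Matrix.rank_mul_eq_left_of_isUnit_det g _ hg, h1,
    Matrix.rank_mul_eq_right_of_isUnit_det g _ hg]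

lemma rank_pow_le_of_mul_eq_smul_mul (l : Nat.Partition d) {X Y : Matrix (Fin d) (Fin d) F} {q : F}
    (hYX : Y * X = q • (X * Y)) {β : Fin d → F} (hβ : Function.Injective β)
    (hroot : ∀ a, X.charpoly.IsRoot (β a))
    (hpos : ∀ a b, q * β a = β b → pos l b = pos l a + 1) (t : ℕ) :
    (Y ^ t).rank ≤ tailCard l t := by
  have h1 (a : Fin d) : ∃ v : Fin d → F, v ≠ 0 ∧ X *ᵥ v = β a • v := by
    have h2 := hroot a
    rw [IsRoot, Matrix.eval_charpoly, ← Matrix.exists_mulVec_eq_zero_iff] at h2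
    obtain ⟨v, hv, hv'⟩ := h2
    refine ⟨v, hv, ?_⟩
    rw [Matrix.sub_mulVec, sub_eq_zero] at hv'
    rw [← hv']
    simp
  choose v hv hv' using h1
  have hli : LinearIndependent F v :=
    Module.End.eigenvectors_linearIndependent' (Matrix.toLin' X) β hβ v fun a => by
      rw [Module.End.hasEigenvector_iff, Module.End.mem_eigenspace_iff]
      exact ⟨hv' a, hv a⟩
  let V : Matrix (Fin d) (Fin d) F := (Matrix.of v)ᵀ
  have hV : IsUnit V.det := by
    rw [← Matrix.isUnit_iff_isUnit_det, ← Matrix.linearIndependent_cols_iff_isUnit]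
    exact hli
  have hXV : X * V = V * Matrix.diagonal β := by
    ext b a
    rw [Matrix.mul_diagonal]
    have := congrFun (hv' a) b
    rw [Pi.smul_apply, smul_eq_mul, mul_comm] at this
    exact this
  have hVV : V * V⁻¹ = 1 := Matrix.mul_nonsing_inv _ hV
  have hVV' : V⁻¹ * V = 1 := Matrix.nonsing_inv_mul _ hV
  have hYV : Y * V = V * (V⁻¹ * Y * V) := by
    rw [Matrix.mul_assoc, ← Matrix.mul_assoc V, hVV, Matrix.one_mul]
  rw [rank_pow_of_mul_eq hV hYV]
  refine rank_pow_le l (fun a b hab => hpos a b ?_) t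
  have hD : V⁻¹ * X * V = Matrix.diagonal β := by
    rw [Matrix.mul_assoc, hXV, ← Matrix.mul_assoc, hVV', Matrix.one_mul]
  have h3 : (V⁻¹ * Y * V) * Matrix.diagonal β = q • (Matrix.diagonal β * (V⁻¹ * Y * V)) := by
    rw [← hD]
    have h4 (A B : Matrix (Fin d) (Fin d) F) :
        V⁻¹ * A * V * (V⁻¹ * B * V) = V⁻¹ * (A * B) * V := by
      calc _ = V⁻¹ * A * (V * V⁻¹) * B * V := by simp only [Matrix.mul_assoc]
        _ = _ := by rw [hVV, Matrix.mul_one]; simp only [Matrix.mul_assoc]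
    rw [h4, h4, hYX, Matrix.mul_smul, Matrix.smul_mul]
  have h5 := congrFun (congrFun h3 a) b
  rw [Matrix.mul_diagonal, Matrix.smul_apply, Matrix.diagonal_mul, smul_eq_mul] at h5
  refine mul_right_cancel₀ hab ?_
  rw [mul_assoc, ← h5, mul_comm]

end Rank

section Specialization

variable {R E K : Type} [CommRing R] [Field E] [IsAlgClosed E] [Algebra R E] [Field K] {d : ℕ}

/-- Distinct integral eigenvalues of a specialization lift to eigenvalues over a large field. -/
lemma exists_lift_eigenvalues (ψ : R →+* K) (h : RingHom.ker (algebraMap R E) ≤ RingHom.ker ψ)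
    (X : Matrix (Fin d) (Fin d) R) (α : Fin d → ℕ)
    (hX : X.map ψ = Matrix.diagonal fun a => (α a : K)) :
    ∃ (Q : Ideal (integralClosure R E)) (β : Fin d → integralClosure R E),
      Q.comap (algebraMap R (integralClosure R E)) = RingHom.ker ψ ∧
      ∀ a, (X.map (algebraMap R E)).charpoly.IsRoot (β a) ∧
        (α a : integralClosure R E) - β a ∈ Q := by
  have : (RingHom.ker ψ).IsPrime := RingHom.ker_isPrime ψ
  have h1 : Ideal.comap (algebraMap R (integralClosure R E)) ⊥ ≤ RingHom.ker ψ := by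
    refine le_trans (fun x hx => ?_) h
    rw [Ideal.mem_comap, Ideal.mem_bot] at hx
    rw [RingHom.mem_ker, IsScalarTower.algebraMap_apply R (integralClosure R E) E, hx, map_zero]
  obtain ⟨Q, -, hQ, hQψ⟩ := Ideal.exists_ideal_over_prime_of_isIntegral (RingHom.ker ψ) ⊥ h1
  have h2 (a : Fin d) : ∃ β : integralClosure R E,
      (X.map (algebraMap R E)).charpoly.IsRoot β ∧ (α a : integralClosure R E) - β ∈ Q := by
    let χ := (X.map (algebraMap R E)).charpoly
    have hχ : χ = X.charpoly.map (algebraMap R E) := Matrix.charpoly_map _ _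
    have hmonic : χ.Monic := Matrix.charpoly_monic _
    have hint (r : E) (hr : r ∈ χ.roots) : r ∈ integralClosure R E := by
      refine ⟨X.charpoly, Matrix.charpoly_monic _, ?_⟩
      rw [Polynomial.eval₂_eq_eval_map, ← hχ]
      exact (Polynomial.mem_roots hmonic.ne_zero).1 hr
    let s : Multiset (integralClosure R E) :=
      χ.roots.attach.map fun r => (α a : integralClosure R E) - ⟨r.1, hint r.1 r.2⟩
    have hs : s.prod = algebraMap R (integralClosure R E) (X.charpoly.eval (α a : R)) := by
      apply Subtype.val_injective
      have h3 : (s.prod : E) = (χ.roots.map fun r => (α a : E) - r).prod := by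
        rw [← Subalgebra.coe_val, map_multiset_prod, Multiset.map_map,
          ← Multiset.attach_map_val' χ.roots fun r => (α a : E) - r]
        congr 1
      have h4 : χ.eval (α a : E) = (χ.roots.map fun r => (α a : E) - r).prod := by
        conv_lhs => rw [(IsAlgClosed.splits χ).eq_prod_roots_of_monic hmonic]
        rw [Polynomial.eval_multiset_prod, Multiset.map_map]
        simp
      rw [h3, ← h4, hχ]
      change _ = algebraMap R E _
      rw [← map_natCast (algebraMap R E), Polynomial.eval_map_apply]
    have h5 : s.prod ∈ Q := by
      rw [hs, ← Ideal.mem_comap, hQψ, RingHom.mem_ker, ← Polynomial.eval_map_apply,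
        ← Matrix.charpoly_map]
      change (X.map ψ).charpoly.eval _ = 0
      rw [hX, Matrix.charpoly_diagonal, Polynomial.eval_prod, map_natCast]
      exact Finset.prod_eq_zero (Finset.mem_univ a) (by simp)
    obtain ⟨y, hy, hyQ⟩ := (hQ.multiset_prod_mem_iff_exists_mem s).1 h5
    obtain ⟨r, -, rfl⟩ := Multiset.mem_map.1 hy
    exact ⟨_, (Polynomial.mem_roots hmonic.ne_zero).1 r.2, hyQ⟩
  choose β hβ using h2
  exact ⟨Q, β, hQψ, hβ⟩

/-- The Jordan type is constant under a specialization to a point at which the semilinear operator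
has eigenvalues in general position. -/
lemma eq_of_specialization [CharZero K] (ψ : R →+* K)
    (h : RingHom.ker (algebraMap R E) ≤ RingHom.ker ψ) {l m : Nat.Partition d}
    {X Y : Matrix (Fin d) (Fin d) R} (q : ℕ)
    (hYX : Y.map (algebraMap R E) * X.map (algebraMap R E) =
      (q : E) • (X.map (algebraMap R E) * Y.map (algebraMap R E)))
    {g : Matrix (Fin d) (Fin d) E} (hg : IsUnit g.det)
    (hYg : Y.map (algebraMap R E) * g = g * jordan l E)
    (hY : Y.map ψ = jordan m K) {α : Fin d → ℕ} (hα : Function.Injective α)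
    (hpos : ∀ a b, q * α a = α b → pos m b = pos m a + 1)
    (hX : X.map ψ = Matrix.diagonal fun a => (α a : K)) : l = m := by
  refine eq_of_tailCard fun t => ?_
  have h1 : ((Y.map (algebraMap R E)) ^ t).rank = tailCard l t := by
    rw [rank_pow_of_mul_eq hg hYg, rank_jordan_pow]
  rw [← h1]
  refine le_antisymm ?_ ?_
  · obtain ⟨Q, β, hQ, hβ⟩ := exists_lift_eigenvalues ψ h X α hX
    have hnat (n n' : ℕ) (hn : (n : integralClosure R E) - n' ∈ Q) : n = n' := by
      have h2 : (n : R) - n' ∈ Q.comap (algebraMap R (integralClosure R E)) := by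
        rw [Ideal.mem_comap]
        simpa using hn
      rw [hQ, RingHom.mem_ker, map_sub, map_natCast, map_natCast, sub_eq_zero] at h2
      exact_mod_cast h2
    refine rank_pow_le_of_mul_eq_smul_mul m hYX (β := fun a => (β a : E)) (fun a b hab => ?_)
      (fun a => (hβ a).1) (fun a b hab => hpos a b (hnat _ _ ?_)) t
    · refine hα (hnat _ _ ?_)
      have h2 := Q.sub_mem (hβ a).2 (hβ b).2
      rw [Subtype.val_injective hab] at h2
      simpa using h2
    · have h2 : (q : integralClosure R E) * β a = β b := Subtype.val_injective (by simpa using hab)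
      have h3 := Q.sub_mem (Q.mul_mem_left (q : integralClosure R E) (hβ a).2) (hβ b).2
      rw [mul_sub, h2] at h3
      simpa using h3
  · obtain ⟨r, hr⟩ := exists_submatrix_jordan_pow m t
    rw [tailCard_eq_card]
    refine card_le_rank_of_submatrix _ r (fun b => b.1) fun h0 => ?_
    let D : R := ((Y ^ t).submatrix r (fun b : {b // t ≤ pos m b} => b.1)).det
    have hD : D ∈ RingHom.ker (algebraMap R E) := by
      rw [RingHom.mem_ker, RingHom.map_det, ← h0, ← RingHom.mapMatrix_apply, ← map_pow]
      rfl
    have hD' : ψ D = 1 := by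
      rw [RingHom.map_det, ← Matrix.det_one (n := {b // t ≤ pos m b}), ← hr K, ← hY,
        ← RingHom.mapMatrix_apply (f := ψ), ← map_pow]
      rfl
    have h2 := h hD
    rw [RingHom.mem_ker, hD'] at h2
    exact one_ne_zero h2

end Specialization

section Point

lemma pow_mul_succ_pow_inj {p : ℕ} (hp : 2 ≤ p) {u v r s : ℕ}
    (h : p ^ u * (p + 1) ^ r = p ^ v * (p + 1) ^ s) : u = v ∧ r = s := by
  have h1 {u v r s : ℕ} (h : p ^ u * (p + 1) ^ r = p ^ v * (p + 1) ^ s) : u ≤ v := by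
    have h2 : Nat.Coprime (p ^ u) ((p + 1) ^ s) :=
      Nat.Coprime.pow _ _ (Nat.coprime_self_add_right.2 (Nat.coprime_one_right p))
    have h3 : p ^ u ∣ p ^ v := h2.dvd_of_dvd_mul_right (h ▸ dvd_mul_right _ _)
    exact (Nat.pow_dvd_pow_iff_le_right hp).1 h3
  have h2 : u = v := le_antisymm (h1 h) (h1 h.symm)
  subst h2
  exact ⟨rfl, Nat.pow_right_injective (by omega) (Nat.eq_of_mul_eq_mul_left (by positivity) h)⟩

variable {d : ℕ}

/-- A diagonal matrix intertwining a Jordan matrix with its `p`-multiple, with distinct entries. -/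
noncomputable def weight (l : Nat.Partition d) (p : ℕ) (a : Fin d) : ℕ :=
  p ^ pos l a * (p + 1) ^ row l a

lemma weight_injective (l : Nat.Partition d) {p : ℕ} (hp : 2 ≤ p) :
    Function.Injective (weight l p) := fun a b h => by
  obtain ⟨h1, h2⟩ := pow_mul_succ_pow_inj hp h
  exact eq_of_row_pos l h2 h1

lemma pos_eq_of_mul_weight (l : Nat.Partition d) {p : ℕ} (hp : 2 ≤ p) {a b : Fin d}
    (h : p * weight l p a = weight l p b) : pos l b = pos l a + 1 := by
  rw [weight, ← mul_assoc, ← pow_succ'] at h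
  exact (pow_mul_succ_pow_inj hp h).1.symm

lemma diagonal_weight_mul_jordan (l : Nat.Partition d) (p : ℕ) (R : Type*) [CommRing R] :
    (p : R) • (Matrix.diagonal (fun a => (weight l p a : R)) * jordan l R) =
      jordan l R * Matrix.diagonal fun a => (weight l p a : R) := by
  ext a b
  simp only [Matrix.smul_apply, Matrix.diagonal_mul, Matrix.mul_diagonal, jordan_apply,
    smul_eq_mul]
  split_ifs with h
  · rw [weight, weight, h.1, h.2]
    push_cast
    ring
  · simp

lemma cycProd_const {f : ℕ} [NeZero f] {R : Type*} [CommRing R] (D : Matrix (Fin d) (Fin d) R)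
    (n : ℕ) : cycProd (fun _ : Fin f => D) n = D ^ n := by
  induction n with
  | zero => rw [pow_zero]; rfl
  | succ n ih => rw [pow_succ', ← ih]; rfl

lemma exists_point {k : Type} [Field k] [CharZero k] {f : ℕ} [NeZero f] {p : ℕ} (hp : 2 ≤ p)
    (l : Nat.Partition d) :
    ∃ φ : PKLoc k d f →ₐ[k] k, relIdeal k p d f ≤ RingHom.ker φ ∧
      (∀ i, (YmatL k d f i).map φ = jordan l k) ∧
      (cycProd (XmatL k d f) f).map φ = Matrix.diagonal fun a => ((weight l p a ^ f : ℕ) : k) := by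
  obtain ⟨φ, hX, hY⟩ := exists_locHom (k := k)
    (fun _ : Fin f => Matrix.diagonal fun a => (weight l p a : k)) (fun _ => jordan l k)
    (fun _ => by
      rw [isUnit_iff_ne_zero, Matrix.det_diagonal, Finset.prod_ne_zero_iff]
      intro a _
      exact Nat.cast_ne_zero.2 (mul_ne_zero (pow_ne_zero _ (by omega)) (by positivity)))
  refine ⟨φ, (relIdeal_le_ker_iff p φ).2 fun i => ?_, hY, ?_⟩
  · rw [hX, hY, hY, diagonal_weight_mul_jordan]
  · refine (cycProd_map (φ : PKLoc k d f →+* k) _ _).trans ?_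
    rw [show (fun i => (XmatL k d f i).map (φ : PKLoc k d f →+* k)) =
      fun _ => Matrix.diagonal fun a => (weight l p a : k) from funext hX, cycProd_const,
      Matrix.diagonal_pow]
    congr 1
    ext a
    simp

end Point

section MinimalPrimes

lemma exists_field_ker_eq (k : Type) [Field k] {A : Type} [CommRing A] [Algebra k A] (Q : Ideal A)
    [Q.IsPrime] : ∃ (F : Type) (_ : Field F) (_ : Algebra k F) (ψ : A →ₐ[k] F),
      RingHom.ker ψ = Q := by
  refine ⟨FractionRing (A ⧸ Q), inferInstance, inferInstance,
    (IsScalarTower.toAlgHom k (A ⧸ Q) (FractionRing (A ⧸ Q))).comp (Ideal.Quotient.mkₐ k Q), ?_⟩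
  ext x
  rw [RingHom.mem_ker, ← Ideal.Quotient.eq_zero_iff_mem]
  exact map_eq_zero_iff _ (IsFractionRing.injective (A ⧸ Q) (FractionRing (A ⧸ Q)))

variable {k : Type} [Field k] [CharZero k] {d f : ℕ} [NeZero f] {p : ℕ}

lemma eq_of_ker_le_ker (hp : 2 ≤ p) {l m : Nat.Partition d} {L : Type} [CommRing L] [IsDomain L]
    [Algebra k L] (φ : PKLoc k d f →ₐ[k] L) {g : Matrix (Fin d) (Fin d) L}
    (hφ : relIdeal k p d f ≤ RingHom.ker φ) (hg : IsUnit g.det)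
    (hYg : (YmatL k d f (-1)).map φ * g = g * jordan l L)
    (h : ∀ ψ : PKLoc k d f →ₐ[k] k, relIdeal k p d f ≤ RingHom.ker ψ →
      (∀ i, (YmatL k d f i).map ψ = jordan m k) → RingHom.ker φ ≤ RingHom.ker ψ) : l = m := by
  obtain ⟨ψ, hψ, hψY, hψX⟩ := exists_point (k := k) (f := f) hp m
  let E := AlgebraicClosure (FractionRing L)
  let ι : L →+* E := (algebraMap (FractionRing L) E).comp (algebraMap L (FractionRing L))
  have hι : Function.Injective ι :=
    (algebraMap (FractionRing L) E).injective.comp (IsFractionRing.injective L (FractionRing L))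
  let _ : Algebra (PKLoc k d f) E := (ι.comp (φ : PKLoc k d f →+* L)).toAlgebra
  have hmap (M : Matrix (Fin d) (Fin d) (PKLoc k d f)) :
      M.map (algebraMap (PKLoc k d f) E) = (M.map φ).map ι := by
    rw [Matrix.map_map]
    rfl
  have hrel := mul_cycProd_self (R := L) (X := fun i => (XmatL k d f i).map φ)
    (Y := fun i => (YmatL k d f i).map φ) ((relIdeal_le_ker_iff p φ).1 hφ)
  have hcyc : (cycProd (XmatL k d f) f).map φ = cycProd (fun i => (XmatL k d f i).map φ) f :=
    cycProd_map (φ : PKLoc k d f →+* L) _ _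
  have hinj : Function.Injective fun n : ℕ => n ^ f := Nat.pow_left_injective (NeZero.ne f)
  refine eq_of_specialization (E := E) (ψ : PKLoc k d f →+* k) (fun x hx => ?_)
    (X := cycProd (XmatL k d f) f) (Y := YmatL k d f (-1)) (p ^ f) ?_ (g := g.map ι) ?_ ?_
    (hψY _) (α := fun a => weight m p a ^ f) (hinj.comp (weight_injective m hp))
    (fun a b hab => pos_eq_of_mul_weight m hp (hinj ?_)) hψX
  · refine h ψ hψ hψY ?_
    rw [RingHom.mem_ker] at hx ⊢
    exact (map_eq_zero_iff ι hι).1 hx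
  · rw [hmap, hmap, hcyc, ← Matrix.map_mul, hrel, ← Matrix.map_mul]
    generalize cycProd (fun i => (XmatL k d f i).map φ) f * (YmatL k d f (-1)).map φ = M
    ext a b
    simp
  · rw [← RingHom.mapMatrix_apply, ← RingHom.map_det]
    exact hg.map ι
  · rw [hmap, ← Matrix.map_mul, hYg, Matrix.map_mul, jordan_map]
  · simpa only [mul_pow] using hab

lemma exists_minimalPrimes_eq_range (hp : p.Prime) :
    ∃ P : Nat.Partition d → Ideal (PKLoc k d f), Function.Injective P ∧
      (relIdeal k p d f).minimalPrimes = Set.range P := by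
  choose P hP hIP hP' hPψ using
    fun l : Nat.Partition d => exists_component (k := k) (f := f) hp.ne_zero l
  have hle {l m : Nat.Partition d} (hlm : P l ≤ P m) : l = m := by
    obtain ⟨L, _, _, _, φ, g, hφ, hg⟩ := hP' l
    refine eq_of_ker_le_ker hp.two_le φ (hφ.symm ▸ hIP l) (hg (-1)).1 (hg (-1)).2
      fun ψ hψ hψY => ?_
    rw [hφ]
    refine hlm.trans (hPψ m k ψ (fun _ => 1) hψ fun i => ⟨by simp, ?_⟩)
    rw [hψY, Matrix.mul_one, Matrix.one_mul]
  have hex (Q : Ideal (PKLoc k d f)) (hQ : Q.IsPrime) (hIQ : relIdeal k p d f ≤ Q) :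
      ∃ l, P l ≤ Q := by
    obtain ⟨F, _, _, ψ, hker⟩ := exists_field_ker_eq k Q
    have : CharZero F := charZero_of_injective_algebraMap (algebraMap k F).injective
    have hIψ : relIdeal k p d f ≤ RingHom.ker ψ := hker.symm ▸ hIQ
    obtain ⟨l, g, hg⟩ := exists_mul_eq_mul_jordan_of_cyclic hp
      (Y := fun i => (YmatL k d f i).map ψ) (isUnit_det_map_XmatL ψ)
      ((relIdeal_le_ker_iff p ψ).1 hIψ)
    exact ⟨l, hker ▸ hPψ l F ψ g hIψ hg⟩
  refine ⟨P, fun l m hlm => hle hlm.le, Set.ext fun Q => ⟨fun hQ => ?_, ?_⟩⟩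
  · obtain ⟨l, hl⟩ := hex Q hQ.1.1 hQ.1.2
    exact ⟨l, le_antisymm hl (hQ.2 ⟨hP l, hIP l⟩ hl)⟩
  · rintro ⟨l, rfl⟩
    refine ⟨⟨hP l, hIP l⟩, fun Q hQ hQl => ?_⟩
    obtain ⟨m, hm⟩ := hex Q hQ.1 hQ.2
    rwa [hle (hm.trans hQl)] at hm

end MinimalPrimes

end PhiN

/-- **Theorem 3.2 (ThmReduced), irreducible components.** Over an algebraically closed
field `k` of characteristic zero, the set of minimal primes of `A/I` is finite and its
cardinality equals the number of partitions of `d`. -/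
theorem statement2 [CharZero k] [IsAlgClosed k] [NeZero f] (hp : p.Prime) (hd : 1 ≤ d) :
    (minimalPrimes (PKLoc k d f ⧸ relIdeal k p d f)).Finite ∧
      Nat.card ↥(minimalPrimes (PKLoc k d f ⧸ relIdeal k p d f)) =
        Fintype.card (Nat.Partition d) := by
  obtain ⟨P, hP, hmin⟩ := PhiN.exists_minimalPrimes_eq_range (k := k) (d := d) (f := f) hp
  have hcomap : Function.Injective (Ideal.comap (Ideal.Quotient.mk (relIdeal k p d f))) :=
    Ideal.comap_injective_of_surjective _ Ideal.Quotient.mk_surjective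
  have himage := (Ideal.minimalPrimes_eq_comap (I := relIdeal k p d f)).symm.trans hmin
  constructor
  · refine Set.Finite.of_finite_image ?_ hcomap.injOn
    rw [himage]
    exact Set.finite_range P
  · rw [← Nat.card_image_of_injective hcomap, himage, ← Nat.card_eq_fintype_card]
    exact Nat.card_congr (Equiv.ofInjective P hP).symm
end
end

section
/- Let L be a field of characteristic zero, let p be a prime number and f ≥ 1 an integer, and set c := p^f regarded as an element of L. Let λ₁,…,λ_d ∈ L be pairwise distinct nonzero elements and let F := diag(λ₁,…,λ_d) be the corresponding diagonal d×d matrix. Let N = (n_{ij}) be a d×d matrix over L such that for all i,j: n_{ij} = 0 if and only if λ_j ≠ c·λ_i. Then the map h : Lᵈ × Mat_{d×d}(L) → Mat_{d×d}(L) defined by h(a, B) := (B·F − c·F·B) + (N·diag(a₁,…,a_d) − c·diag(a₁,…,a_d)·N) is surjective. -/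
/-- If `c` is nonzero and no positive power of `c` is `1`, the inhomogeneous recursion
`a j = c * a i + g i j` along the pairs with `lam j = c * lam i` has a solution. -/
theorem exists_solution_of_scaling_recursion {ι L : Type*} [Finite ι] [Field L] {c : L}
    (hc0 : c ≠ 0) (hc : ∀ n : ℕ, c ^ (n + 1) ≠ 1) {lam : ι → L} (hlam : ∀ i, lam i ≠ 0)
    (hinj : Function.Injective lam) (g : ι → ι → L) :
    ∃ a : ι → L, ∀ i j, lam j = c * lam i → a j = c * a i + g i j := by
  classical
  let r : ι → ι → Prop := fun i j => ∃ n : ℕ, lam j = c ^ (n + 1) * lam i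
  have : IsTrans ι r := ⟨by
    rintro i j k ⟨m, hm⟩ ⟨n, hn⟩
    exact ⟨m + n + 1, by rw [hn, hm]; ring⟩⟩
  have : Std.Irrefl r := ⟨by
    rintro i ⟨n, hn⟩
    exact hc n (mul_right_cancel₀ (hlam i) (by rw [← hn, one_mul]))⟩
  have wf : WellFounded r := Finite.wellFounded_of_trans_of_irrefl r
  let step : ∀ j, (∀ i, r i j → L) → L := fun j a =>
    if h : ∃ i, lam j = c * lam i then
      c * a h.choose ⟨0, by simpa using h.choose_spec⟩ + g h.choose j
    else 0
  refine ⟨wf.fix step, fun i j hij => ?_⟩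
  have h : ∃ i, lam j = c * lam i := ⟨i, hij⟩
  have hi : h.choose = i :=
    hinj (mul_left_cancel₀ hc0 (h.choose_spec.symm.trans hij))
  rw [wf.fix_eq step j]
  simp only [step, dif_pos h]
  rw [hi]

/-- The deformation-lifting surjectivity step in the proof of Theorem 3.2 (ThmReduced):
with `F = diag(λ₁,…,λ_d)` having pairwise distinct nonzero eigenvalues, `c = p^f`, and
`N` a matrix whose entry `n_{ij}` vanishes exactly when `λ_j ≠ c·λ_i`, the map
`h(a,B) = (B·F − c·F·B) + (N·diag(a) − c·diag(a)·N)` is surjective. -/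
theorem statement4 (L : Type) [Field L] [CharZero L] (p f d : ℕ)
    (hp : p.Prime) (hf : 1 ≤ f) (c : L) (hc : c = (p : L) ^ f)
    (lam : Fin d → L) (hlam : ∀ i, lam i ≠ 0) (hinj : Function.Injective lam)
    (N : Matrix (Fin d) (Fin d) L)
    (hN : ∀ i j, N i j = 0 ↔ lam j ≠ c * lam i) :
    Function.Surjective (fun x : (Fin d → L) × Matrix (Fin d) (Fin d) L =>
      (x.2 * Matrix.diagonal lam - c • (Matrix.diagonal lam * x.2)) +
      (N * Matrix.diagonal x.1 - c • (Matrix.diagonal x.1 * N))) := by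
  have hp1 : 1 < p ^ f := Nat.one_lt_pow (by lia) hp.one_lt
  have hc' : c = ((p ^ f : ℕ) : L) := by rw [hc, Nat.cast_pow]
  have hc0 : c ≠ 0 := by
    rw [hc', Nat.cast_ne_zero]
    lia
  have hc1 : ∀ n : ℕ, c ^ (n + 1) ≠ 1 := fun n h => by
    rw [hc', ← Nat.cast_pow, Nat.cast_eq_one] at h
    exact (Nat.one_lt_pow n.succ_ne_zero hp1).ne' h
  intro M
  obtain ⟨a, ha⟩ := exists_solution_of_scaling_recursion hc0 hc1 hlam hinj
    (fun i j => M i j / N i j)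
  refine ⟨(a, Matrix.of fun i j => M i j / (lam j - c * lam i)), ?_⟩
  ext i j
  simp only [Matrix.add_apply, Matrix.sub_apply, Matrix.smul_apply, Matrix.mul_diagonal,
    Matrix.diagonal_mul, Matrix.of_apply, smul_eq_mul]
  by_cases hij : lam j = c * lam i
  · have hne : N i j ≠ 0 := fun h => (hN i j).1 h hij
    rw [ha i j hij, hij]
    field_simp
    ring
  · have hne : lam j - c * lam i ≠ 0 := sub_ne_zero.2 hij
    rw [(hN i j).2 hij]
    field_simp
    ring
end

section
/- Let L be a field of characteristic zero, let p be a prime number and f ≥ 1 an integer. Let V be a finite-dimensional L-vector space of dimension d ≥ 1, let Φ : V → V be an L-linear automorphism and N : V → V an L-linear endomorphism satisfying N∘Φ = p^f·(Φ∘N). Then N^d = 0. -/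
open Polynomial in
/-- If an algebra automorphism scales an integral element by a scalar that is not a root of unity,
then the minimal polynomial of that element is a power of `X`. -/
lemma minpoly_eq_X_pow_of_algEquiv_eq_smul {K A : Type*} [Field K] [Ring A] [Algebra K A]
    {q : K} (hq : ∀ n : ℕ, n ≠ 0 → q ^ n ≠ 1) (σ : A ≃ₐ[K] A) {a : A} (ha : IsIntegral K a)
    (h : σ a = q • a) : minpoly K a = X ^ (minpoly K a).natDegree := by
  have hscale : (minpoly K a).scaleRoots q = minpoly K a := by
    refine eq_of_monic_of_dvd_of_natDegree_le (minpoly.monic ha)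
      ((monic_scaleRoots_iff q).2 (minpoly.monic ha)) ?_ (natDegree_scaleRoots _ _).le
    rw [← minpoly.algEquiv_eq σ a, h]
    refine minpoly.dvd K _ ?_
    rw [← h, minpoly.algEquiv_eq, h, Algebra.smul_def]
    exact scaleRoots_aeval_eq_zero (minpoly.aeval K a)
  ext i
  rw [coeff_X_pow]
  split_ifs with hi
  · rw [hi]
    exact minpoly.monic ha
  · rcases lt_or_gt_of_ne hi with hlt | hgt
    · have hcoeff := congrArg (fun r : K[X] => r.coeff i) hscale
      rw [coeff_scaleRoots] at hcoeff
      by_contra hne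
      exact hq _ (Nat.sub_ne_zero_of_lt hlt) (mul_left_cancel₀ hne (hcoeff.trans (mul_one _).symm))
    · exact coeff_eq_zero_of_natDegree_lt hgt

/-- **Lemma 2.2(b) (LemmaNnilpot), field case.** If `Φ` is a linear automorphism of a
`d`-dimensional vector space `V` over a field `L` of characteristic zero and `N` is a linear
endomorphism with `N ∘ Φ = p^f • (Φ ∘ N)`, then `N^d = 0`. -/
theorem statement5 (L : Type) [Field L] [CharZero L] (p f : ℕ) (hp : p.Prime) (hf : 1 ≤ f)
    (V : Type) [AddCommGroup V] [Module L V] [FiniteDimensional L V]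
    (d : ℕ) (hd : 1 ≤ d) (hdim : Module.finrank L V = d)
    (Φ : V ≃ₗ[L] V) (N : Module.End L V)
    (hrel : N ∘ₗ (Φ : V →ₗ[L] V) = ((p : L) ^ f) • ((Φ : V →ₗ[L] V) ∘ₗ N)) :
    N ^ d = 0 := by
  have hq : ∀ n : ℕ, n ≠ 0 → ((p : L) ^ f) ^ n ≠ 1 := by
    intro n hn h
    rw [← pow_mul] at h
    have hfn : f * n ≠ 0 := Nat.mul_ne_zero (by omega) hn
    exact (Nat.one_lt_pow hfn hp.one_lt).ne' (by exact_mod_cast h)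
  have hconj : Φ.symm.conjAlgEquiv L N = ((p : L) ^ f) • N := by
    ext v
    have hv := LinearMap.congr_fun hrel v
    simp only [LinearMap.comp_apply, LinearMap.smul_apply, LinearEquiv.coe_coe] at hv
    simp [LinearEquiv.conjAlgEquiv_apply, hv]
  have hint : IsIntegral L N := Algebra.IsIntegral.isIntegral N
  have hpow := minpoly_eq_X_pow_of_algEquiv_eq_smul hq _ hint hconj
  have hzero : N ^ (minpoly L N).natDegree = 0 := by
    have h := minpoly.aeval L N
    rwa [hpow, Polynomial.aeval_X_pow] at h
  refine pow_eq_zero_of_le ?_ hzero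
  rw [← hdim, ← LinearMap.charpoly_natDegree N]
  exact Polynomial.natDegree_le_of_dvd (LinearMap.minpoly_dvd_charpoly N)
    (LinearMap.charpoly_monic N).ne_zero
end

section
/- Let R be a commutative ring, M an R-module, and let Φ, N : M → M be R-linear endomorphisms. Suppose c ∈ R satisfies Φ∘N = c·(N∘Φ). Then for every λ ∈ R and every natural number k, one has (Φ − c·λ·id)^k ∘ N = c^k · (N ∘ (Φ − λ·id)^k). In particular, N maps ker((Φ − λ·id)^k) into ker((Φ − c·λ·id)^k), i.e., N maps the generalized eigenspace of Φ for the eigenvalue λ into the generalized eigenspace for the eigenvalue c·λ. -/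
theorem pow_mul_eq_smul_mul_pow {R A : Type*} [CommSemiring R] [Semiring A] [Algebra R A]
    {a b n : A} {c : R} (h : a * n = c • (n * b)) (k : ℕ) :
    a ^ k * n = c ^ k • (n * b ^ k) := by
  induction k with
  | zero => simp
  | succ k ih =>
    rw [pow_succ, mul_assoc, h, mul_smul_comm, ← mul_assoc, ih, smul_mul_assoc, smul_smul,
      mul_assoc, ← pow_succ, ← pow_succ']

/-- The key linear-algebra step in Lemma 2.2(b) (LemmaNnilpot): if `Φ ∘ N = c • (N ∘ Φ)`
then `(Φ − c·λ·id)^k ∘ N = c^k • (N ∘ (Φ − λ·id)^k)`; in particular `N` maps the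
generalized eigenspace of `Φ` for `λ` into the one for `c·λ`. -/
theorem statement6 (R : Type) [CommRing R] (M : Type) [AddCommGroup M] [Module R M]
    (Φ N : Module.End R M) (c : R) (h : Φ ∘ₗ N = c • (N ∘ₗ Φ)) (lam : R) (k : ℕ) :
    (((Φ - (c * lam) • (1 : Module.End R M)) ^ k) ∘ₗ N =
      c ^ k • (N ∘ₗ ((Φ - lam • (1 : Module.End R M)) ^ k))) ∧
    (∀ x ∈ LinearMap.ker ((Φ - lam • (1 : Module.End R M)) ^ k),
      N x ∈ LinearMap.ker ((Φ - (c * lam) • (1 : Module.End R M)) ^ k)) := by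
  have hshift : (Φ - (c * lam) • (1 : Module.End R M)) * N =
      c • (N * (Φ - lam • (1 : Module.End R M))) := by
    have h' : Φ * N = c • (N * Φ) := h
    rw [sub_mul, mul_sub, smul_sub, h', smul_mul_assoc, mul_smul_comm, one_mul, mul_one, smul_smul]
  have hpow : ((Φ - (c * lam) • (1 : Module.End R M)) ^ k) ∘ₗ N =
      c ^ k • (N ∘ₗ ((Φ - lam • (1 : Module.End R M)) ^ k)) :=
    pow_mul_eq_smul_mul_pow hshift k
  refine ⟨hpow, fun x hx => ?_⟩
  rw [LinearMap.mem_ker] at hx ⊢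
  rw [← LinearMap.comp_apply, hpow, LinearMap.smul_apply, LinearMap.comp_apply, hx, map_zero,
    smul_zero]
end

section
/- Let p be a prime, K a finite field extension of ℚ_p, and R a commutative ℚ_p-algebra. Set A := R ⊗_{ℚ_p} K, let B⁺ := A[[t]] be the power series ring over A, and B := B⁺[1/t] its localization at t. Let P be a finite free B⁺-module of rank d and V := P ⊗_{B⁺} B. Then a B⁺-submodule q ⊆ V satisfies the three conditions (a) q is a finitely generated B⁺-module, (b) q is a direct summand of V as an R-module, and (c) the B-submodule generated by q is all of V, if and only if there exist integers n, m ≥ 0 with tⁿ·P ⊆ q ⊆ t^{−m}·P such that the R-modules (t^{−m}P)/q and q/(tⁿP) are finitely generated and projective; moreover, in that case, for every pair of integers n, m ≥ 0 with tⁿ·P ⊆ q ⊆ t^{−m}·P the quotients (t^{−m}P)/q and q/(tⁿP) are finitely generated projective R-modules. -/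
set_option maxHeartbeats 1000000
set_option synthInstance.maxHeartbeats 400000

noncomputable section

open scoped TensorProduct

variable (p : ℕ) [Fact p.Prime]
variable (K : Type) [Field K] [Algebra ℚ_[p] K] [FiniteDimensional ℚ_[p] K]
variable (R : Type) [CommRing R] [Algebra ℚ_[p] R]

/-- `A := R ⊗_{ℚ_p} K`. -/
abbrev BaseA := R ⊗[ℚ_[p]] K

/-- `B⁺ := A[[t]]`. -/
abbrev BPlus := PowerSeries (BaseA p K R)

/-- `B := B⁺[1/t]`, the localization of `B⁺` at `t`. -/
abbrev Bt := Localization.Away (PowerSeries.X : BPlus p K R)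

variable (d : ℕ)

/-- `V := P ⊗_{B⁺} B`, realized as the free `B`-module of rank `d` containing the
standard free rank-`d` lattice `P`. -/
abbrev Vmod := Fin d → Bt p K R

/-- The image of `t` in `B`. -/
def tB : Bt p K R := algebraMap (BPlus p K R) (Bt p K R) PowerSeries.X

/-- The inverse `t⁻¹` of `t` in `B`. -/
def tInv : Bt p K R := Localization.mk 1 ⟨PowerSeries.X, Submonoid.mem_powers _⟩

/-- For `b : B`, the `B⁺`-submodule `b·P` of `V`, where `P` is the standard lattice. -/
def stdLatt (b : Bt p K R) : Submodule (BPlus p K R) (Vmod p K R d) :=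
  Submodule.span (BPlus p K R) (Set.range fun i : Fin d => Pi.single i b)

/-- The `R`-module quotient `q/s` of two `B⁺`-submodules of `V`. -/
abbrev subQuot (q s : Submodule (BPlus p K R) (Vmod p K R d)) :=
  ↥(q.restrictScalars R) ⧸
    Submodule.comap (q.restrictScalars R).subtype (s.restrictScalars R)

/-- The three conditions defining a Hodge–Pink (`B⁺_R`-)lattice: `q` is a finitely
generated `B⁺`-module, a direct summand of `V` as `R`-module, and generates `V` over `B`. -/
def IsHPLattice (q : Submodule (BPlus p K R) (Vmod p K R d)) : Prop :=
  q.FG ∧ (∃ c : Submodule R (Vmod p K R d), IsCompl (q.restrictScalars R) c) ∧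
    Submodule.span (Bt p K R) (q : Set (Vmod p K R d)) = ⊤

/-- The quotients `t^{−m}P/q` and `q/tⁿP` are finitely generated projective `R`-modules. -/
def QuotsFGProj (q : Submodule (BPlus p K R) (Vmod p K R d)) (n m : ℕ) : Prop :=
  Module.Finite R (subQuot p K R d (stdLatt p K R d (tInv p K R ^ m)) q) ∧
  Module.Projective R (subQuot p K R d (stdLatt p K R d (tInv p K R ^ m)) q) ∧
  Module.Finite R (subQuot p K R d q (stdLatt p K R d (tB p K R ^ n))) ∧
  Module.Projective R (subQuot p K R d q (stdLatt p K R d (tB p K R ^ n)))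

section ModuleTheory

variable {S M : Type*} [CommRing S] [AddCommGroup M] [Module S M]

/-- If `q` has a complement in `M` and `s ≤ q ≤ l` with `l/s` finite projective, then `l/q` and
`q/s` are finite projective. -/
theorem finite_projective_quotients_of_isCompl {q c s l : Submodule S M} (hqc : IsCompl q c)
    (hsq : s ≤ q) (hql : q ≤ l) [Module.Finite S (l ⧸ s.submoduleOf l)]
    [Module.Projective S (l ⧸ s.submoduleOf l)] :
    (Module.Finite S (l ⧸ q.submoduleOf l) ∧ Module.Projective S (l ⧸ q.submoduleOf l)) ∧
      Module.Finite S (q ⧸ s.submoduleOf q) ∧ Module.Projective S (q ⧸ s.submoduleOf q) := by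
  have hproj : ∀ x ∈ q, q.projection c hqc x = x := fun x hx ↦
    Submodule.projection_apply_of_mem_left hqc hx
  let toQuot : (l ⧸ s.submoduleOf l) →ₗ[S] l ⧸ q.submoduleOf l :=
    Submodule.factor fun x hx ↦ hsq hx
  let rest : l →ₗ[S] l := (LinearMap.id - q.projection c hqc).restrict fun x hx ↦
    l.sub_mem hx (hql (Submodule.projection_apply_mem hqc x))
  let ofQuot : (l ⧸ q.submoduleOf l) →ₗ[S] l ⧸ s.submoduleOf l :=
    Submodule.mapQ _ _ rest fun x hx ↦ by
      have h : (rest x : M) = 0 := sub_eq_zero.mpr (hproj x hx).symm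
      change (rest x : M) ∈ s
      rw [h]
      exact s.zero_mem
  have h₁ : toQuot ∘ₗ ofQuot = LinearMap.id := by
    ext x
    change Submodule.Quotient.mk (rest x) = Submodule.Quotient.mk x
    rw [Submodule.Quotient.eq]
    change ((x : M) - q.projection c hqc x) - x ∈ q
    rw [sub_sub_cancel_left]
    exact q.neg_mem (Submodule.projection_apply_mem hqc _)
  let incl : (q ⧸ s.submoduleOf q) →ₗ[S] l ⧸ s.submoduleOf l :=
    Submodule.mapQ _ _ (Submodule.inclusion hql) fun x hx ↦ hx
  let retr : (l ⧸ s.submoduleOf l) →ₗ[S] q ⧸ s.submoduleOf q :=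
    Submodule.mapQ _ _ (q.projectionOnto c hqc ∘ₗ l.subtype) fun x hx ↦ by
      have h : q.projection c hqc x = x := hproj x (hsq hx)
      change q.projection c hqc x ∈ s
      rw [h]
      exact hx
  have h₂ : retr ∘ₗ incl = LinearMap.id := by
    ext x
    exact congrArg Submodule.Quotient.mk (Submodule.projectionOnto_apply_left hqc x)
  exact ⟨⟨.of_surjective toQuot fun x ↦ ⟨ofQuot x, LinearMap.congr_fun h₁ x⟩,
    .of_split ofQuot toQuot h₁⟩,
    .of_surjective retr fun x ↦ ⟨incl x, LinearMap.congr_fun h₂ x⟩,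
    .of_split incl retr h₂⟩

/-- If `q ≤ l` with `l/q` projective and `l` has a complement in `M`, then so does `q`. -/
theorem exists_isCompl_of_projective_quotient {q l c : Submodule S M} (hlc : IsCompl l c)
    (hql : q ≤ l) [Module.Projective S (l ⧸ q.submoduleOf l)] :
    ∃ c' : Submodule S M, IsCompl q c' := by
  obtain ⟨σ, hσ⟩ := Module.projective_lifting_property (q.submoduleOf l).mkQ LinearMap.id
    (Submodule.mkQ_surjective _)
  let f : l →ₗ[S] l := LinearMap.id - σ ∘ₗ (q.submoduleOf l).mkQ
  have hf : ∀ x, l.subtype (f x) ∈ q := fun x ↦ by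
    change f x ∈ q.submoduleOf l
    rw [← Submodule.Quotient.mk_eq_zero, ← Submodule.mkQ_apply]
    have := LinearMap.congr_fun hσ ((q.submoduleOf l).mkQ x)
    simp only [LinearMap.comp_apply, LinearMap.id_apply] at this
    simp only [f, LinearMap.sub_apply, LinearMap.id_apply, LinearMap.comp_apply, map_sub, this,
      sub_self]
  refine ⟨_, LinearMap.isCompl_of_proj
    (f := (LinearMap.codRestrict q (l.subtype ∘ₗ f) hf) ∘ₗ l.projectionOnto c hlc) fun x ↦ ?_⟩
  have hx : (q.submoduleOf l).mkQ ⟨x, hql x.2⟩ = 0 :=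
    (Submodule.Quotient.mk_eq_zero _).mpr x.2
  ext
  simp only [LinearMap.comp_apply, Submodule.projectionOnto_apply_of_mem_left hlc (hql x.2)]
  simp only [LinearMap.codRestrict_apply, LinearMap.comp_apply, f, LinearMap.sub_apply, hx,
    map_zero, sub_zero, LinearMap.id_apply, Submodule.subtype_apply]

end ModuleTheory

section Laurent

open PowerSeries

variable (A : Type*) [CommRing A]

/-- The localization of `A⟦X⟧` at `X` is the ring of Laurent series. -/
def laurentEquiv : Localization.Away (X : A⟦X⟧) ≃ₐ[A⟦X⟧] LaurentSeries A :=
  IsLocalization.algEquiv (Submonoid.powers (X : A⟦X⟧)) _ _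

variable {A}

theorem laurentEquiv_algebraMap (f : A⟦X⟧) :
    laurentEquiv A (algebraMap _ _ f) = HahnSeries.ofPowerSeries ℤ A f :=
  (laurentEquiv A).commutes f

theorem laurentEquiv_smul (f : A⟦X⟧) (x : Localization.Away (X : A⟦X⟧)) :
    laurentEquiv A (f • x) = HahnSeries.ofPowerSeries ℤ A f * laurentEquiv A x := by
  rw [Algebra.smul_def, map_mul, laurentEquiv_algebraMap]

/-- An element of `A⟦X⟧[1/X]` is a power series multiple of `X ^ a` iff its Laurent coefficients
below `a` vanish. -/
theorem exists_eq_smul_iff_coeff {b : Localization.Away (X : A⟦X⟧)} {a : ℤ}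
    (hb : laurentEquiv A b = HahnSeries.single a 1) (x : Localization.Away (X : A⟦X⟧)) :
    (∃ f : A⟦X⟧, f • b = x) ↔ ∀ k < a, (laurentEquiv A x).coeff k = 0 := by
  constructor
  · rintro ⟨f, rfl⟩ k hk
    rw [laurentEquiv_smul, hb, HahnSeries.coeff_mul_single, PowerSeries.coeff_coe,
      if_pos (by lia), zero_mul]
  · intro h
    refine ⟨PowerSeries.mk fun j ↦ (laurentEquiv A x).coeff (a + j), ?_⟩
    apply (laurentEquiv A).injective
    ext k
    rw [laurentEquiv_smul, hb, HahnSeries.coeff_mul_single, PowerSeries.coeff_coe, mul_one]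
    split_ifs with hk
    · exact (h k (by lia)).symm
    · rw [PowerSeries.coeff_mk]
      congr
      lia

variable (S : Type*) [CommRing S] [Algebra S A]

/-- The `k`-th Laurent coefficient as a linear map. -/
def laurentCoeff (k : ℤ) : Localization.Away (X : A⟦X⟧) →ₗ[S] A where
  toFun x := (laurentEquiv A x).coeff k
  map_add' x y := by simp
  map_smul' r x := by
    rw [← algebraMap_smul A⟦X⟧ r x, laurentEquiv_smul, PowerSeries.algebraMap_apply,
      HahnSeries.ofPowerSeries_C, HahnSeries.C_mul_eq_smul, HahnSeries.coeff_smul,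
      RingHom.id_apply, smul_eq_mul, Algebra.smul_def]

theorem exists_laurentCoeff_eq (a : ℤ) (g : ℕ → A) :
    ∃ x : Localization.Away (X : A⟦X⟧), (∀ j : ℕ, laurentCoeff S (a + j) x = g j) ∧
      ∀ k < a, laurentCoeff S k x = 0 := by
  refine ⟨(laurentEquiv A).symm
    (HahnSeries.ofPowerSeries ℤ A (PowerSeries.mk g) * HahnSeries.single a 1), fun j ↦ ?_,
    fun k hk ↦ ?_⟩
  · simp only [laurentCoeff, LinearMap.coe_mk, AddHom.coe_mk, AlgEquiv.apply_symm_apply,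
      HahnSeries.coeff_mul_single, add_sub_cancel_left, LaurentSeries.coeff_coe_powerSeries,
      PowerSeries.coeff_mk, mul_one]
  · simp only [laurentCoeff, LinearMap.coe_mk, AddHom.coe_mk, AlgEquiv.apply_symm_apply,
      HahnSeries.coeff_mul_single, PowerSeries.coeff_coe]
    rw [if_pos (by lia), zero_mul]

theorem eq_zero_of_laurentCoeff_eq_zero {x : Localization.Away (X : A⟦X⟧)}
    (h : ∀ k, laurentCoeff S k x = 0) : x = 0 :=
  (map_eq_zero_iff _ (laurentEquiv A).injective).mp (HahnSeries.ext (funext h))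

theorem exists_forall_lt_laurentCoeff_eq_zero (x : Localization.Away (X : A⟦X⟧)) :
    ∃ m : ℕ, ∀ k < -(m : ℤ), laurentCoeff S k x = 0 := by
  refine ⟨(laurentEquiv A x).order.natAbs, fun k hk ↦ ?_⟩
  exact HahnSeries.coeff_eq_zero_of_lt_order (x := laurentEquiv A x) (i := k) (by lia)

variable (e : ℕ)

/-- The vectors all of whose Laurent coefficients below `a` vanish. -/
def coeffLatt (A : Type*) [CommRing A] [Algebra S A] (a : ℤ) :
    Submodule S (Fin e → Localization.Away (X : A⟦X⟧)) :=
  ⨅ (i : Fin e) (k : ℤ) (_ : k < a), LinearMap.ker (laurentCoeff S k ∘ₗ LinearMap.proj i)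

variable {S e}

theorem mem_coeffLatt {a : ℤ} {v : Fin e → Localization.Away (X : A⟦X⟧)} :
    v ∈ coeffLatt S e A a ↔ ∀ i, ∀ k < a, laurentCoeff S k (v i) = 0 := by
  simp [coeffLatt]

theorem coeffLatt_exists_isCompl (a : ℤ) : ∃ c, IsCompl (coeffLatt S e A a) c := by
  refine ⟨⨅ (i : Fin e) (k : ℤ) (_ : a ≤ k),
    LinearMap.ker (laurentCoeff S k ∘ₗ LinearMap.proj i), ?_, ?_⟩
  · rw [Submodule.disjoint_def]
    intro v hv hv'
    rw [mem_coeffLatt] at hv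
    simp only [Submodule.mem_iInf, LinearMap.mem_ker, LinearMap.comp_apply,
      LinearMap.proj_apply] at hv'
    refine funext fun i ↦ eq_zero_of_laurentCoeff_eq_zero S fun k ↦ ?_
    rcases lt_or_ge k a with h | h
    exacts [hv i k h, hv' i k h]
  · rw [codisjoint_iff, eq_top_iff]
    intro v _
    choose w hw hw' using fun i ↦
      exists_laurentCoeff_eq S a (fun j ↦ laurentCoeff S (a + j) (v i))
    refine Submodule.mem_sup.mpr ⟨w, mem_coeffLatt.mpr hw', v - w, ?_, add_sub_cancel _ _⟩
    simp only [Submodule.mem_iInf, LinearMap.mem_ker, LinearMap.comp_apply,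
      LinearMap.proj_apply, map_sub]
    intro i k hk
    obtain ⟨j, rfl⟩ := Int.le.dest hk
    rw [hw, sub_self]

/-- Truncated lattices are free modules over the coefficient ring. -/
def coeffLattQuotEquiv (a : ℤ) (N : ℕ) :
    (coeffLatt S e A a ⧸ (coeffLatt S e A (a + N)).submoduleOf (coeffLatt S e A a)) ≃ₗ[S]
      (Fin e → Fin N → A) :=
  let f : coeffLatt S e A a →ₗ[S] (Fin e → Fin N → A) :=
    LinearMap.pi fun i ↦ LinearMap.pi fun j ↦
      laurentCoeff S (a + (j : ℕ)) ∘ₗ LinearMap.proj i ∘ₗ Submodule.subtype _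
  have hker : (coeffLatt S e A (a + N)).submoduleOf (coeffLatt S e A a) = LinearMap.ker f := by
    ext v
    have hv := mem_coeffLatt.mp v.2
    rw [Submodule.submoduleOf, Submodule.mem_comap, Submodule.subtype_apply, mem_coeffLatt,
      LinearMap.mem_ker]
    constructor
    · exact fun h ↦ funext fun i ↦ funext fun j ↦ h i _ (by have := j.2; lia)
    · intro h i k hk
      rcases lt_or_ge k a with h' | h'
      · exact hv i k h'
      · obtain ⟨j, rfl⟩ := Int.le.dest h'
        exact congrFun (congrFun h i) ⟨j, by lia⟩
  have hsurj : Function.Surjective f := by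
    intro g
    choose w hw hw' using fun i ↦
      exists_laurentCoeff_eq S a (fun j ↦ if h : j < N then g i ⟨j, h⟩ else 0)
    refine ⟨⟨w, mem_coeffLatt.mpr hw'⟩, ?_⟩
    ext i j
    change laurentCoeff S (a + (j : ℕ)) (w i) = _
    rw [hw, dif_pos j.2]
  (Submodule.quotEquivOfEq _ _ hker).trans (f.quotKerEquivOfSurjective hsurj)

end Laurent

section Lattice

set_option linter.unusedSectionVars false

theorem mem_stdLatt {b : Bt p K R} {v : Vmod p K R d} :
    v ∈ stdLatt p K R d b ↔ ∀ i, ∃ f : BPlus p K R, f • b = v i := by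
  rw [stdLatt, Submodule.mem_span_range_iff_exists_fun]
  simp only [← Pi.single_smul', Finset.univ_sum_single, funext_iff]
  exact ⟨fun ⟨c, hc⟩ i ↦ ⟨c i, hc i⟩, fun h ↦ Classical.skolem.mp h⟩

theorem laurentEquiv_tB_pow (n : ℕ) :
    laurentEquiv (BaseA p K R) (tB p K R ^ n) = HahnSeries.single (n : ℤ) 1 := by
  rw [map_pow, tB, laurentEquiv_algebraMap, HahnSeries.ofPowerSeries_X, HahnSeries.single_pow,
    one_pow, nsmul_one]

theorem tB_mul_tInv : tB p K R * tInv p K R = 1 := by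
  rw [tB, tInv, ← Localization.mk_one_eq_algebraMap, Localization.mk_mul, mul_one, one_mul,
    Localization.mk_self_mk]

theorem laurentEquiv_tInv_pow (m : ℕ) :
    laurentEquiv (BaseA p K R) (tInv p K R ^ m) = HahnSeries.single (-(m : ℤ)) 1 := by
  have h : laurentEquiv (BaseA p K R) (tB p K R ^ m) *
      laurentEquiv (BaseA p K R) (tInv p K R ^ m) = 1 := by
    rw [← map_mul, ← mul_pow, tB_mul_tInv, one_pow, map_one]
  have h' : HahnSeries.single (-(m : ℤ)) 1 * laurentEquiv (BaseA p K R) (tB p K R ^ m) = 1 := by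
    rw [laurentEquiv_tB_pow, HahnSeries.single_mul_single, neg_add_cancel, one_mul]
    rfl
  exact (left_inv_eq_right_inv h' h).symm

theorem mem_stdLatt_iff_coeff {b : Bt p K R} {a : ℤ}
    (hb : laurentEquiv (BaseA p K R) b = HahnSeries.single a 1) {v : Vmod p K R d} :
    v ∈ stdLatt p K R d b ↔ ∀ i, ∀ k < a, laurentCoeff R k (v i) = 0 :=
  (mem_stdLatt p K R d).trans (forall_congr' fun i ↦ exists_eq_smul_iff_coeff hb (v i))

theorem stdLatt_restrictScalars {b : Bt p K R} {a : ℤ}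
    (hb : laurentEquiv (BaseA p K R) b = HahnSeries.single a 1) :
    (stdLatt p K R d b).restrictScalars R = coeffLatt R d (BaseA p K R) a :=
  Submodule.ext fun _ ↦ (mem_stdLatt_iff_coeff p K R d hb).trans mem_coeffLatt.symm

/-- A quotient `t^{-m}P / tⁿP` is a finite projective `R`-module. -/
theorem finite_projective_stdLatt_quotient (n m : ℕ) :
    Module.Finite R (subQuot p K R d (stdLatt p K R d (tInv p K R ^ m))
      (stdLatt p K R d (tB p K R ^ n))) ∧
    Module.Projective R (subQuot p K R d (stdLatt p K R d (tInv p K R ^ m))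
      (stdLatt p K R d (tB p K R ^ n))) := by
  have key : ∀ l s : Submodule R (Vmod p K R d), l = coeffLatt R d (BaseA p K R) (-(m : ℤ)) →
      s = coeffLatt R d (BaseA p K R) n →
      Module.Finite R (l ⧸ s.submoduleOf l) ∧ Module.Projective R (l ⧸ s.submoduleOf l) := by
    rintro _ _ rfl rfl
    have e := coeffLattQuotEquiv (S := R) (e := d) (A := BaseA p K R) (-(m : ℤ)) (m + n)
    rw [show -(m : ℤ) + ((m + n : ℕ) : ℤ) = n by push_cast; ring] at e
    exact ⟨.equiv e.symm, .of_equiv e.symm⟩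
  exact key _ _ (stdLatt_restrictScalars p K R d (laurentEquiv_tInv_pow p K R m))
    (stdLatt_restrictScalars p K R d (laurentEquiv_tB_pow p K R n))

theorem quotsFGProj_of_isCompl {q : Submodule (BPlus p K R) (Vmod p K R d)}
    {c : Submodule R (Vmod p K R d)} (hc : IsCompl (q.restrictScalars R) c) {n m : ℕ}
    (hn : stdLatt p K R d (tB p K R ^ n) ≤ q) (hm : q ≤ stdLatt p K R d (tInv p K R ^ m)) :
    QuotsFGProj p K R d q n m := by
  obtain ⟨h₁, h₂⟩ := finite_projective_stdLatt_quotient p K R d n m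
  change Module.Finite R (((stdLatt p K R d (tInv p K R ^ m)).restrictScalars R) ⧸
    ((stdLatt p K R d (tB p K R ^ n)).restrictScalars R).submoduleOf _) at h₁
  change Module.Projective R (((stdLatt p K R d (tInv p K R ^ m)).restrictScalars R) ⧸
    ((stdLatt p K R d (tB p K R ^ n)).restrictScalars R).submoduleOf _) at h₂
  obtain ⟨⟨h₃, h₄⟩, h₅, h₆⟩ := finite_projective_quotients_of_isCompl hc
    (s := (stdLatt p K R d (tB p K R ^ n)).restrictScalars R)
    (l := (stdLatt p K R d (tInv p K R ^ m)).restrictScalars R) (fun x hx ↦ hn hx)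
    fun x hx ↦ hm hx
  exact ⟨h₃, h₄, h₅, h₆⟩

theorem exists_le_stdLatt_tInv_pow {q : Submodule (BPlus p K R) (Vmod p K R d)} (hq : q.FG) :
    ∃ m : ℕ, q ≤ stdLatt p K R d (tInv p K R ^ m) := by
  obtain ⟨s, rfl⟩ := hq
  choose m hm using fun (v : Vmod p K R d) (i : Fin d) ↦
    exists_forall_lt_laurentCoeff_eq_zero R (v i)
  refine ⟨s.sup fun v ↦ Finset.univ.sup (m v), Submodule.span_le.mpr fun v hv ↦
    (mem_stdLatt_iff_coeff p K R d (laurentEquiv_tInv_pow p K R _)).mpr fun i k hk ↦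
    hm v i k (lt_of_lt_of_le hk ?_)⟩
  have h₁ : m v i ≤ Finset.univ.sup (m v) := Finset.le_sup (Finset.mem_univ i)
  have h₂ : Finset.univ.sup (m v) ≤ s.sup fun v ↦ Finset.univ.sup (m v) :=
    Finset.le_sup (f := fun v ↦ Finset.univ.sup (m v)) hv
  lia

theorem exists_X_pow_smul_mem {q : Submodule (BPlus p K R) (Vmod p K R d)}
    {v : Vmod p K R d} (hv : v ∈ Submodule.span (Bt p K R) (q : Set (Vmod p K R d))) :
    ∃ n : ℕ, (PowerSeries.X : BPlus p K R) ^ n • v ∈ q := by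
  induction hv using Submodule.span_induction with
  | mem x hx => exact ⟨0, by rwa [pow_zero, one_smul]⟩
  | zero => exact ⟨0, by rw [smul_zero]; exact q.zero_mem⟩
  | add x y _ _ hx hy =>
    obtain ⟨n, hn⟩ := hx
    obtain ⟨k, hk⟩ := hy
    refine ⟨n + k, ?_⟩
    rw [smul_add]
    refine q.add_mem ?_ ?_
    · rw [pow_add, mul_comm, mul_smul]
      exact q.smul_mem _ hn
    · rw [pow_add, mul_smul]
      exact q.smul_mem _ hk
  | smul b x _ hx =>
    obtain ⟨n, hn⟩ := hx
    obtain ⟨⟨f, _, k, rfl⟩, hf⟩ :=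
      IsLocalization.surj (Submonoid.powers (PowerSeries.X : BPlus p K R)) b
    refine ⟨n + k, ?_⟩
    have h : (PowerSeries.X : BPlus p K R) ^ k • b • x = f • x := by
      rw [← algebraMap_smul (Bt p K R) (_ ^ k), smul_smul, mul_comm, ← algebraMap_smul (Bt p K R) f]
      exact congrArg (· • x) hf
    rw [pow_add, mul_smul, h, smul_comm]
    exact q.smul_mem _ hn

theorem exists_stdLatt_tB_pow_le {q : Submodule (BPlus p K R) (Vmod p K R d)}
    (hq : Submodule.span (Bt p K R) (q : Set (Vmod p K R d)) = ⊤) :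
    ∃ n : ℕ, stdLatt p K R d (tB p K R ^ n) ≤ q := by
  choose n hn using fun i : Fin d ↦ exists_X_pow_smul_mem p K R d (q := q)
    (v := Pi.single i 1) (hq ▸ Submodule.mem_top)
  refine ⟨Finset.univ.sup n, Submodule.span_le.mpr ?_⟩
  rintro _ ⟨i, rfl⟩
  have h : (Pi.single i (tB p K R ^ Finset.univ.sup n) : Vmod p K R d) =
      (PowerSeries.X : BPlus p K R) ^ (Finset.univ.sup n) • Pi.single i 1 := by
    rw [← Pi.single_smul', Algebra.smul_def, mul_one, map_pow]
    rfl
  obtain ⟨k, hk⟩ := Nat.exists_eq_add_of_le (Finset.le_sup (f := n) (Finset.mem_univ i))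
  change Pi.single i _ ∈ q
  rw [h, hk, pow_add, mul_comm, mul_smul]
  exact q.smul_mem _ (hn i)

theorem span_eq_top_of_stdLatt_le {q : Submodule (BPlus p K R) (Vmod p K R d)} {n : ℕ}
    (hn : stdLatt p K R d (tB p K R ^ n) ≤ q) :
    Submodule.span (Bt p K R) (q : Set (Vmod p K R d)) = ⊤ := by
  rw [eq_top_iff, ← (Pi.basisFun (Bt p K R) (Fin d)).span_eq, Submodule.span_le]
  rintro _ ⟨i, rfl⟩
  have h : (Pi.basisFun (Bt p K R) (Fin d) i) =
      tInv p K R ^ n • (Pi.single i (tB p K R ^ n) : Vmod p K R d) := by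
    rw [Pi.basisFun_apply, ← Pi.single_smul', smul_eq_mul, mul_comm, ← mul_pow, tB_mul_tInv,
      one_pow]
  rw [SetLike.mem_coe, h]
  exact Submodule.smul_mem _ _ (Submodule.subset_span (hn (Submodule.subset_span ⟨i, rfl⟩)))

theorem fg_of_finite_subQuot {q s : Submodule (BPlus p K R) (Vmod p K R d)} (hs : s.FG)
    (hsq : s ≤ q) [Module.Finite R (subQuot p K R d q s)] : q.FG := by
  obtain ⟨t, ht⟩ := hs
  obtain ⟨g, hg⟩ := Module.Finite.fg_top (R := R) (M := subQuot p K R d q s)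
  choose l hl using Submodule.mkQ_surjective
    (Submodule.comap (q.restrictScalars R).subtype (s.restrictScalars R))
  classical
  refine ⟨t ∪ g.image fun x ↦ (l x : Vmod p K R d), le_antisymm ?_ fun v hv ↦ ?_⟩
  · rw [Submodule.span_le, Finset.coe_union, Set.union_subset_iff]
    refine ⟨fun x hx ↦ hsq (ht ▸ Submodule.subset_span hx), fun x hx ↦ ?_⟩
    obtain ⟨y, -, rfl⟩ := Finset.mem_image.mp hx
    exact (l y).2
  set w := Submodule.span (BPlus p K R)
    ((t ∪ g.image fun x ↦ (l x : Vmod p K R d) : Finset (Vmod p K R d)) : Set (Vmod p K R d))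
  have hsw : s ≤ w := ht ▸ Submodule.span_mono (Finset.coe_subset.mpr Finset.subset_union_left)
  have key : (⊤ : Submodule R (subQuot p K R d q s)) ≤
      ((w.restrictScalars R).comap (q.restrictScalars R).subtype).map (Submodule.mkQ _) := by
    rw [← hg, Submodule.span_le]
    exact fun x hx ↦ ⟨l x, Submodule.subset_span
      (Finset.mem_union_right _ (Finset.mem_image_of_mem _ hx)), hl x⟩
  obtain ⟨u, hu, huv⟩ := key (Submodule.mem_top (x := Submodule.Quotient.mk ⟨v, hv⟩))
  have h : v - (u : Vmod p K R d) ∈ s := 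
    (Submodule.Quotient.eq (Submodule.comap (q.restrictScalars R).subtype
      (s.restrictScalars R))).mp huv.symm
  simpa using w.add_mem (hsw h) hu

end Lattice

/-- **Lemma 2.5 (LemmaHPLattice), equivalence.** A `B⁺`-submodule `q ⊆ V` is a
Hodge–Pink lattice iff `tⁿP ⊆ q ⊆ t^{−m}P` for some `n,m ≥ 0` with finitely generated
projective quotients over `R`; and in that case the quotients are finitely generated
projective for every such pair `n, m`. -/
theorem statement7 (q : Submodule (BPlus p K R) (Vmod p K R d)) :
    (IsHPLattice p K R d q ↔
      ∃ n m : ℕ, stdLatt p K R d (tB p K R ^ n) ≤ q ∧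
        q ≤ stdLatt p K R d (tInv p K R ^ m) ∧ QuotsFGProj p K R d q n m) ∧
    (IsHPLattice p K R d q →
      ∀ n m : ℕ, stdLatt p K R d (tB p K R ^ n) ≤ q →
        q ≤ stdLatt p K R d (tInv p K R ^ m) → QuotsFGProj p K R d q n m) := by
  refine ⟨⟨?_, ?_⟩, ?_⟩
  · rintro ⟨hfg, ⟨c, hc⟩, hspan⟩
    obtain ⟨n, hn⟩ := exists_stdLatt_tB_pow_le p K R d hspan
    obtain ⟨m, hm⟩ := exists_le_stdLatt_tInv_pow p K R d hfg
    exact ⟨n, m, hn, hm, quotsFGProj_of_isCompl p K R d hc hn hm⟩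
  · rintro ⟨n, m, hn, hm, -, hproj, hfin, -⟩
    refine ⟨fg_of_finite_subQuot p K R d (s := stdLatt p K R d (tB p K R ^ n))
      (Submodule.fg_span (Set.finite_range _)) hn, ?_, span_eq_top_of_stdLatt_le p K R d hn⟩
    obtain ⟨c, hc⟩ := coeffLatt_exists_isCompl (S := R) (e := d) (A := BaseA p K R) (-(m : ℤ))
    rw [← stdLatt_restrictScalars p K R d (laurentEquiv_tInv_pow p K R m)] at hc
    have : Module.Projective R (((stdLatt p K R d (tInv p K R ^ m)).restrictScalars R) ⧸
        (q.restrictScalars R).submoduleOf _) := hproj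
    exact exists_isCompl_of_projective_quotient hc fun x hx ↦ hm hx
  · rintro ⟨-, ⟨c, hc⟩, -⟩ n m hn hm
    exact quotsFGProj_of_isCompl p K R d hc hn hm
end
end

section
/- Let p be a prime, K a finite field extension of ℚ_p, and R a commutative ℚ_p-algebra. Set A := R ⊗_{ℚ_p} K, let B⁺ := A[[t]] be the power series ring over A, and B := B⁺[1/t] its localization at t. Let P be a finite free B⁺-module of rank d and V := P ⊗_{B⁺} B. Let q ⊆ V be a B⁺-submodule such that there exist integers n, m ≥ 0 with tⁿ·P ⊆ q ⊆ t^{−m}·P and such that the R-modules (t^{−m}P)/q and q/(tⁿP) are finitely generated and projective. Then q is a finitely generated projective B⁺-module. -/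
set_option maxHeartbeats 1000000
set_option synthInstance.maxHeartbeats 400000

noncomputable section

open scoped TensorProduct

variable (p : ℕ) [Fact p.Prime]
variable (K : Type) [Field K] [Algebra ℚ_[p] K] [FiniteDimensional ℚ_[p] K]
variable (R : Type) [CommRing R] [Algebra ℚ_[p] R]

variable (d : ℕ)

section

open scoped PowerSeries

/-- A form of Schanuel's lemma: if one finite projective presentation of a module has a finite
projective kernel, then so has every other. -/
theorem finite_projective_ker_of_finite_projective_ker {B M F Q : Type*} [CommRing B]
    [AddCommGroup M] [Module B M] [AddCommGroup F] [Module B F] [AddCommGroup Q] [Module B Q]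
    [Module.Finite B M] [Module.Projective B M] [Module.Projective B F]
    (f : M →ₗ[B] Q) (hf : Function.Surjective f) (g : F →ₗ[B] Q) (hg : Function.Surjective g)
    [Module.Finite B (LinearMap.ker g)] [Module.Projective B (LinearMap.ker g)] :
    Module.Finite B (LinearMap.ker f) ∧ Module.Projective B (LinearMap.ker f) := by
  obtain ⟨φ, hφ⟩ := Module.projective_lifting_property g f hg
  obtain ⟨ψ, hψ⟩ := Module.projective_lifting_property f g hf
  have hφ' (x : M) : g (φ x) = f x := LinearMap.congr_fun hφ x
  have hψ' (x : F) : f (ψ x) = g x := LinearMap.congr_fun hψ x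
  let i : LinearMap.ker f →ₗ[B] M × LinearMap.ker g :=
    (LinearMap.ker f).subtype.prod
      ((φ ∘ₗ (LinearMap.ker f).subtype).codRestrict (LinearMap.ker g) fun x => by simp [hφ'])
  let r : M × LinearMap.ker g →ₗ[B] LinearMap.ker f :=
    LinearMap.codRestrict (LinearMap.ker f)
      ((LinearMap.id - ψ ∘ₗ φ).coprod (ψ ∘ₗ (LinearMap.ker g).subtype)) fun x => by
        simp [hφ', hψ']
  have hri : r ∘ₗ i = LinearMap.id := by
    exact LinearMap.ext fun x => Subtype.ext (sub_add_cancel (x : M) (ψ (φ x)))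
  exact ⟨Module.Finite.of_surjective r fun x => ⟨i x, LinearMap.congr_fun hri x⟩,
    Module.Projective.of_split i r hri⟩

/-- If `X` acts nilpotently on a finite projective `A`-module `Q`, the kernel of the action map
`A⟦X⟧ ⊗[A] Q → Q` is isomorphic to `A⟦X⟧ ⊗[A] Q` via `X ⊗ 1 - 1 ⊗ X`. In particular it is finite
and projective. -/
theorem PowerSeries.finite_projective_ker_liftBaseChange {A Q : Type*} [CommRing A]
    [AddCommGroup Q] [Module A Q] [Module A⟦X⟧ Q] [IsScalarTower A A⟦X⟧ Q]
    [Module.Finite A Q] [Module.Projective A Q]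
    (N : ℕ) (hN : ∀ x : Q, (X ^ N : A⟦X⟧) • x = 0) :
    Module.Finite A⟦X⟧ (LinearMap.ker ((LinearMap.id : Q →ₗ[A] Q).liftBaseChange A⟦X⟧)) ∧
    Module.Projective A⟦X⟧
      (LinearMap.ker ((LinearMap.id : Q →ₗ[A] Q).liftBaseChange A⟦X⟧)) := by
  set g := (LinearMap.id : Q →ₗ[A] Q).liftBaseChange A⟦X⟧ with hg
  let τ : Q →ₗ[A] Q := ((LinearMap.lsmul A⟦X⟧ Q) (X : A⟦X⟧)).restrictScalars A
  have hτ (x : Q) : τ x = (X : A⟦X⟧) • x := rfl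
  let s : A⟦X⟧ ⊗[A] Q →ₗ[A⟦X⟧] A⟦X⟧ ⊗[A] Q := τ.baseChange A⟦X⟧
  have hs (b : A⟦X⟧) (x : Q) : s (b ⊗ₜ x) = b ⊗ₜ ((X : A⟦X⟧) • x) := by simp [s, hτ]
  let δ : A⟦X⟧ ⊗[A] Q →ₗ[A⟦X⟧] A⟦X⟧ ⊗[A] Q := (X : A⟦X⟧) • LinearMap.id - s
  have hδ (z : A⟦X⟧ ⊗[A] Q) : δ z = (X : A⟦X⟧) • z - s z := rfl
  have hspow (k : ℕ) (b : A⟦X⟧) (x : Q) : (s ^ k) (b ⊗ₜ x) = b ⊗ₜ ((X ^ k : A⟦X⟧) • x) := by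
    induction k generalizing x with
    | zero => simp
    | succ k ih => rw [pow_succ, Module.End.mul_apply, hs, ih, smul_smul, pow_succ]
  have hsN : s ^ N = 0 := by
    ext x
    simp [hspow, hN]
  have hXinj : Function.Injective fun z : A⟦X⟧ ⊗[A] Q => (X : A⟦X⟧) • z := by
    have h : Function.Injective (LinearMap.mulLeft A (X : A⟦X⟧)) := fun a b hab =>
      PowerSeries.X_mul_cancel hab
    have h2 := Module.Flat.rTensor_preserves_injective_linearMap (M := Q) _ h
    have h3 (z : A⟦X⟧ ⊗[A] Q) :
        (LinearMap.mulLeft A (X : A⟦X⟧)).rTensor Q z = (X : A⟦X⟧) • z := by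
      induction z with
      | zero => simp
      | add x y hx hy => rw [map_add, hx, hy, smul_add]
      | tmul b x => simp [TensorProduct.smul_tmul']
    intro a b hab
    exact h2 (by simpa only [h3] using hab)
  have hδinj : Function.Injective δ := by
    rw [injective_iff_map_eq_zero]
    intro z hz
    have h1 : s z = (X : A⟦X⟧) • z := (sub_eq_zero.mp hz).symm
    have h2 (k : ℕ) : (s ^ k) z = (X ^ k : A⟦X⟧) • z := by
      induction k with
      | zero => simp
      | succ k ih => rw [pow_succ, Module.End.mul_apply, h1, map_smul, ih, smul_smul, pow_succ']
    have h3 : (X ^ N : A⟦X⟧) • z = 0 := by rw [← h2, hsN, LinearMap.zero_apply]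
    refine hXinj.iterate N ?_
    simpa only [smul_iterate_apply, smul_zero] using h3
  have hrange : LinearMap.range δ = LinearMap.ker g := by
    apply le_antisymm
    · rintro _ ⟨z, rfl⟩
      rw [LinearMap.mem_ker, hδ]
      induction z with
      | zero => simp
      | add x y hx hy =>
        rw [smul_add, map_add, add_sub_add_comm, map_add, hx, hy, add_zero]
      | tmul b x => simp [hs, hg, smul_smul, mul_comm]
    · have key (k : ℕ) (b : A⟦X⟧) (x : Q) (hx : (X ^ k : A⟦X⟧) • x = 0) :
          b ⊗ₜ x - 1 ⊗ₜ (b • x) ∈ LinearMap.range δ := by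
        induction k generalizing b x with
        | zero =>
          obtain rfl : x = 0 := by simpa using hx
          simp
        | succ k ih =>
          obtain ⟨c, a, rfl⟩ : ∃ (c : A⟦X⟧) (a : A), b = X * c + C a :=
            ⟨_, _, PowerSeries.eq_X_mul_shift_add_const b⟩
          have h := ih c ((X : A⟦X⟧) • x) (by rw [smul_smul, ← pow_succ, hx])
          have hC : (C a : A⟦X⟧) ⊗ₜ[A] x = 1 ⊗ₜ[A] ((C a : A⟦X⟧) • x) := by
            have : (C a : A⟦X⟧) = a • 1 := by rw [PowerSeries.smul_eq_C_mul, mul_one]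
            rw [this, smul_assoc, one_smul, TensorProduct.smul_tmul]
          have : (X * c + C a) ⊗ₜ[A] x - 1 ⊗ₜ[A] ((X * c + C a) • x) =
              δ (c ⊗ₜ x) + (c ⊗ₜ[A] ((X : A⟦X⟧) • x) - 1 ⊗ₜ[A] (c • (X : A⟦X⟧) • x)) := by
            rw [hδ, hs, TensorProduct.smul_tmul', smul_eq_mul, TensorProduct.add_tmul, hC,
              add_smul, TensorProduct.tmul_add, smul_smul, mul_comm c X]
            abel
          rw [this]
          exact add_mem ⟨_, rfl⟩ h
      intro z hz
      have h (z : A⟦X⟧ ⊗[A] Q) : z - 1 ⊗ₜ[A] (g z) ∈ LinearMap.range δ := by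
        induction z with
        | zero => simp
        | add x y hx hy =>
          rw [map_add, TensorProduct.tmul_add, add_sub_add_comm]
          exact add_mem hx hy
        | tmul b x => simpa [hg] using key N b x (hN x)
      simpa [LinearMap.mem_ker.mp hz] using h z
  let e := (LinearEquiv.ofInjective δ hδinj).trans (LinearEquiv.ofEq _ _ hrange)
  exact ⟨Module.Finite.equiv e, Module.Projective.of_equiv e⟩

/-- If `X` acts nilpotently on a finite projective `A`-module `Q`, the kernel of any surjection onto
`Q` from a finite projective `A⟦X⟧`-module is finite and projective. -/
theorem PowerSeries.finite_projective_ker {A M Q : Type*} [CommRing A]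
    [AddCommGroup Q] [Module A Q] [Module A⟦X⟧ Q] [IsScalarTower A A⟦X⟧ Q]
    [Module.Finite A Q] [Module.Projective A Q] [AddCommGroup M] [Module A⟦X⟧ M]
    [Module.Finite A⟦X⟧ M] [Module.Projective A⟦X⟧ M]
    (N : ℕ) (hN : ∀ x : Q, (X ^ N : A⟦X⟧) • x = 0)
    (f : M →ₗ[A⟦X⟧] Q) (hf : Function.Surjective f) :
    Module.Finite A⟦X⟧ (LinearMap.ker f) ∧ Module.Projective A⟦X⟧ (LinearMap.ker f) := by
  obtain ⟨_, _⟩ := PowerSeries.finite_projective_ker_liftBaseChange (A := A) (Q := Q) N hN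
  exact finite_projective_ker_of_finite_projective_ker f hf
    ((LinearMap.id : Q →ₗ[A] Q).liftBaseChange A⟦X⟧) fun x => ⟨1 ⊗ₜ x, by simp⟩

end

section

set_option linter.unusedSectionVars false

theorem algebraMap_Bt_injective :
    Function.Injective (algebraMap (BPlus p K R) (Bt p K R)) := by
  refine IsLocalization.injective _ (M := Submonoid.powers (PowerSeries.X : BPlus p K R)) ?_
  exact Submonoid.powers_le.mpr (mem_nonZeroDivisors_iff_left.mpr fun y hy =>
    PowerSeries.X_mul_cancel (hy.trans (mul_zero _).symm))

/-- A lattice `b·P` with `b` a unit of `B` is free over `B⁺`. -/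
theorem free_stdLatt {b c : Bt p K R} (hbc : b * c = 1) :
    Module.Free (BPlus p K R) (stdLatt p K R d b) := by
  have hli : LinearIndependent (BPlus p K R) fun i : Fin d => (Pi.single i b : Vmod p K R d) := by
    rw [Fintype.linearIndependent_iff]
    intro g hg i
    have h := congrFun hg i
    simp only [Finset.sum_apply, Pi.smul_apply, Pi.zero_apply] at h
    rw [Finset.sum_eq_single i (fun j _ hj => by rw [Pi.single_eq_of_ne hj.symm, smul_zero])
      (by simp), Pi.single_eq_same, Algebra.smul_def] at h
    apply algebraMap_Bt_injective p K R
    rw [map_zero, ← mul_one (algebraMap _ _ (g i)), ← hbc, ← mul_assoc, h, zero_mul]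
  exact Module.Free.of_basis (Module.Basis.span hli)

theorem X_pow_smul_mem_stdLatt (k : ℕ) {b c : Bt p K R} (hbc : tB p K R ^ k * b = c)
    {x : Vmod p K R d} (hx : x ∈ stdLatt p K R d b) :
    (PowerSeries.X ^ k : BPlus p K R) • x ∈ stdLatt p K R d c := by
  induction hx using Submodule.span_induction with
  | mem x hx =>
    obtain ⟨i, rfl⟩ := hx
    refine Submodule.subset_span ⟨i, ?_⟩
    simp only
    rw [← Pi.single_smul, Algebra.smul_def, map_pow, ← hbc, tB]
  | zero => simp
  | add x y _ _ hx hy => rw [smul_add]; exact add_mem hx hy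
  | smul a x _ hx => rw [smul_comm]; exact Submodule.smul_mem _ _ hx

end

/-- **Lemma 2.5 (LemmaHPLattice), final assertion.** If `tⁿP ⊆ q ⊆ t^{−m}P` with
finitely generated projective quotients over `R`, then `q` is a finitely generated
projective `B⁺`-module. -/
theorem statement8 (q : Submodule (BPlus p K R) (Vmod p K R d)) (n m : ℕ)
    (h1 : stdLatt p K R d (tB p K R ^ n) ≤ q)
    (h2 : q ≤ stdLatt p K R d (tInv p K R ^ m))
    (h3 : Module.Finite R (subQuot p K R d (stdLatt p K R d (tInv p K R ^ m)) q))
    (h4 : Module.Projective R (subQuot p K R d (stdLatt p K R d (tInv p K R ^ m)) q))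
    (h5 : Module.Finite R (subQuot p K R d q (stdLatt p K R d (tB p K R ^ n))))
    (h6 : Module.Projective R (subQuot p K R d q (stdLatt p K R d (tB p K R ^ n)))) :
    Module.Finite (BPlus p K R) ↥q ∧ Module.Projective (BPlus p K R) ↥q := by
  set M := stdLatt p K R d (tInv p K R ^ m) with hM
  have hinv : tB p K R ^ m * tInv p K R ^ m = 1 := by
    rw [← mul_pow, tB_mul_tInv, one_pow]
  have : Module.Free (BPlus p K R) M := free_stdLatt p K R d ((mul_comm _ _).trans hinv)
  have : Module.Finite (BPlus p K R) M := Module.Finite.span_of_finite _ (Set.finite_range _)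
  let e : (M ⧸ q.comap M.subtype) ≃ₗ[R] subQuot p K R d M q :=
    Submodule.Quotient.restrictScalarsEquiv R (q.comap M.subtype)
  have : Module.Finite R (M ⧸ q.comap M.subtype) := Module.Finite.equiv e.symm
  have : Module.Projective R (M ⧸ q.comap M.subtype) := Module.Projective.of_equiv e.symm
  have : Module.Finite (BaseA p K R) (M ⧸ q.comap M.subtype) :=
    Module.Finite.of_restrictScalars_finite R _ _
  have : Algebra.FormallyUnramified ℚ_[p] K := Algebra.FormallyUnramified.of_isSeparable _ _
  have : Module.Projective (BaseA p K R) (M ⧸ q.comap M.subtype) :=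
    Algebra.FormallyUnramified.projective_of_restrictScalars R (BaseA p K R) _
  have hN (x : M ⧸ q.comap M.subtype) : (PowerSeries.X ^ (n + m) : BPlus p K R) • x = 0 := by
    obtain ⟨x, rfl⟩ := Submodule.Quotient.mk_surjective _ x
    rw [← Submodule.Quotient.mk_smul, Submodule.Quotient.mk_eq_zero]
    exact h1 (X_pow_smul_mem_stdLatt p K R d (n + m)
      (by rw [pow_add, mul_assoc, hinv, mul_one]) x.2)
  obtain ⟨_, _⟩ := PowerSeries.finite_projective_ker (n + m) hN _
    (Submodule.mkQ_surjective (q.comap M.subtype))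
  let e' := (LinearEquiv.ofEq _ _ (Submodule.ker_mkQ (q.comap M.subtype))).trans
    (Submodule.comapSubtypeEquivOfLe h2)
  exact ⟨Module.Finite.equiv e', Module.Projective.of_equiv e'⟩
end
end

section
/- Let k be a field, V a finite-dimensional k-vector space, and (Fⁱ)_{i∈ℤ} a decreasing, exhaustive and separated filtration of V by k-subspaces (so F^{i+1} ⊆ Fⁱ for all i, Fⁱ = V for i sufficiently small, and Fⁱ = 0 for i sufficiently large). Let W ⊆ V be a k-subspace, and define the induced filtration on W by (F∩W)ⁱ := Fⁱ ∩ W. Inside V ⊗_k k((t)) define the k[[t]]-submodule q(F•) := Σ_{i∈ℤ} t^{−i}·(Fⁱ ⊗_k k[[t]]), and similarly q((F∩W)•) inside W ⊗_k k((t)). Then q((F∩W)•) = q(F•) ∩ (W ⊗_k k((t))). -/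
set_option maxHeartbeats 1000000
set_option synthInstance.maxHeartbeats 400000

noncomputable section

open scoped TensorProduct

instance (k : Type) [Field k] : SMulCommClass k (PowerSeries k) (LaurentSeries k) :=
  ⟨fun a s x => by
    simp only [Algebra.smul_def, ← HahnSeries.C_mul_eq_smul]
    ring⟩

/-- The `n`-th Laurent coefficient `k((t)) ⊗ V → V`. -/
def tensorCoeff (k : Type) [Field k] (V : Type) [AddCommGroup V] [Module k V] (n : ℤ) :
    LaurentSeries k ⊗[k] V →ₗ[k] V :=
  TensorProduct.lift
    (LinearMap.mk₂ k (fun (c : LaurentSeries k) (v : V) => c.coeff n • v)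
      (fun c d v => by simp [add_smul]) (fun a c v => by simp [mul_smul])
      (fun c v w => by simp) (fun a c v => by rw [smul_comm]))

section TensorCoeff

variable {k : Type} [Field k] {V : Type} [AddCommGroup V] [Module k V]

@[simp]
lemma tensorCoeff_tmul (n : ℤ) (c : LaurentSeries k) (v : V) :
    tensorCoeff k V n (c ⊗ₜ[k] v) = c.coeff n • v := rfl

lemma exists_sum_tmul_basis {ι : Type} [Fintype ι] (e : Module.Basis ι k V)
    (x : LaurentSeries k ⊗[k] V) :
    ∃ c : ι → LaurentSeries k, x = ∑ j, c j ⊗ₜ[k] e j ∧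
      ∀ n j, (c j).coeff n = e.repr (tensorCoeff k V n x) j := by
  classical
  obtain ⟨c, hc⟩ := TensorProduct.eq_repr_basis_right e x
  rw [Finsupp.sum_fintype _ _ (by simp)] at hc
  refine ⟨c, hc.symm, fun n j => ?_⟩
  rw [← hc]
  simp [Finsupp.single_apply]

lemma eq_of_tensorCoeff_eq [FiniteDimensional k V] {x y : LaurentSeries k ⊗[k] V}
    (h : ∀ n, tensorCoeff k V n x = tensorCoeff k V n y) : x = y := by
  obtain ⟨c, hx, hc⟩ := exists_sum_tmul_basis (Module.finBasis k V) x
  obtain ⟨d, hy, hd⟩ := exists_sum_tmul_basis (Module.finBasis k V) y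
  have hcd : c = d := by
    ext j n
    rw [hc, hd, h]
  rw [hx, hy, hcd]

lemma tensorCoeff_lTensor (P : V →ₗ[k] V) (n : ℤ) (x : LaurentSeries k ⊗[k] V) :
    tensorCoeff k V n (P.lTensor (LaurentSeries k) x) = P (tensorCoeff k V n x) := by
  induction x with
  | zero => simp
  | tmul c v => simp
  | add x y hx hy => simp [hx, hy]

lemma exists_powerSeries_smul_single (c : LaurentSeries k) (N : ℤ)
    (h : ∀ n < N, c.coeff n = 0) :
    ∃ p : PowerSeries k, c = p • (HahnSeries.single N 1 : LaurentSeries k) := by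
  refine ⟨PowerSeries.mk fun m => c.coeff (N + m), ?_⟩
  ext n
  rw [Algebra.smul_def, ← sub_add_cancel n N, LaurentSeries.coe_algebraMap,
    HahnSeries.coeff_mul_single_add, mul_one, PowerSeries.coeff_coe]
  split_ifs with hn
  · exact h _ (by omega)
  · rw [PowerSeries.coeff_mk]
    congr 1
    omega

lemma coeff_powerSeries_smul_single (p : PowerSeries k) {N n : ℤ} (h : n < N) :
    (p • (HahnSeries.single N 1 : LaurentSeries k)).coeff n = 0 := by
  rw [Algebra.smul_def, ← sub_add_cancel n N, LaurentSeries.coe_algebraMap,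
    HahnSeries.coeff_mul_single_add, mul_one, PowerSeries.coeff_coe, if_pos (by omega)]

/-- A tensor with all coefficients in `W` and no terms of degree `< N` lies in
`t ^ N • (k[[t]] ⊗ W)`. -/
lemma mem_span_single_tmul [FiniteDimensional k V] (W : Submodule k V) (N : ℤ)
    (x : LaurentSeries k ⊗[k] V) (hW : ∀ n, tensorCoeff k V n x ∈ W)
    (h0 : ∀ n < N, tensorCoeff k V n x = 0) :
    x ∈ Submodule.span (PowerSeries k) {y : LaurentSeries k ⊗[k] V |
      ∃ w ∈ W, y = (HahnSeries.single N 1 : LaurentSeries k) ⊗ₜ[k] w} := by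
  obtain ⟨π, hπ⟩ := W.subtype.exists_leftInverse_of_injective W.ker_subtype
  have hP : ∀ w ∈ W, (W.subtype ∘ₗ π) w = w := fun w hw => by
    simpa using congrArg Subtype.val (LinearMap.congr_fun hπ ⟨w, hw⟩)
  have hx : (W.subtype ∘ₗ π).lTensor (LaurentSeries k) x = x :=
    eq_of_tensorCoeff_eq fun n => by rw [tensorCoeff_lTensor, hP _ (hW n)]
  obtain ⟨c, hxc, hc⟩ := exists_sum_tmul_basis (Module.finBasis k V) x
  rw [← hx, hxc, map_sum]
  refine Submodule.sum_mem _ fun j _ => ?_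
  obtain ⟨p, hp⟩ := exists_powerSeries_smul_single (c j) N fun n hn => by simp [hc, h0 n hn]
  rw [hp, LinearMap.lTensor_tmul, ← TensorProduct.smul_tmul']
  exact Submodule.smul_mem _ _ (Submodule.subset_span ⟨_, (π _).2, rfl⟩)

lemma mem_span_of_tensorCoeff_mem [FiniteDimensional k V] (G : ℤ → Submodule k V)
    (W : Submodule k V) (hGW : ∀ i, G i ≤ W) {a b : ℤ} (ha : W ≤ G a)
    (hb : ∀ i ≥ b, G i = ⊥) (x : LaurentSeries k ⊗[k] V)
    (hx : ∀ n, tensorCoeff k V n x ∈ G (-n)) :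
    x ∈ Submodule.span (PowerSeries k) (⋃ i : ℤ, {x : LaurentSeries k ⊗[k] V |
          ∃ v ∈ G i, x = (HahnSeries.single (-i) 1 : LaurentSeries k) ⊗ₜ[k] v}) := by
  classical
  set y := ∑ m ∈ Finset.Ioo (-b) (-a),
    (HahnSeries.single m 1 : LaurentSeries k) ⊗ₜ[k] tensorCoeff k V m x with hy
  have hyn : ∀ n, tensorCoeff k V n y =
      if n ∈ Finset.Ioo (-b) (-a) then tensorCoeff k V n x else 0 := fun n => by
    simp only [hy, map_sum, tensorCoeff_tmul, HahnSeries.coeff_single, ite_smul, one_smul,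
      zero_smul, Finset.sum_ite_eq]
  rw [← sub_add_cancel x y]
  refine Submodule.add_mem _ ?_ (Submodule.sum_mem _ fun m _ => Submodule.subset_span ?_)
  · refine Submodule.span_mono ?_ (mem_span_single_tmul W (-a) (x - y) (fun n => ?_)
      fun n hn => ?_)
    · rintro _ ⟨w, hw, rfl⟩
      exact Set.mem_iUnion.2 ⟨a, w, ha hw, rfl⟩
    · rw [map_sub, hyn]
      split_ifs
      · simp
      · simpa using hGW _ (hx n)
    · rw [map_sub, hyn]
      split_ifs with h
      · simp
      · have hnb : b ≤ -n := by
          rw [Finset.mem_Ioo] at h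
          omega
        simpa [hb _ hnb] using hx n
  · exact Set.mem_iUnion.2 ⟨-m, _, hx m, by rw [neg_neg]⟩

/-- To bound the coefficients of a `k[[t]]`-span it suffices to bound those of the
`k[[t]]`-multiples of the generators. -/
lemma tensorCoeff_mem_of_mem_span {S : Set (LaurentSeries k ⊗[k] V)} {U : Submodule k V} {n : ℤ}
    (h : ∀ x ∈ S, ∀ p : PowerSeries k, tensorCoeff k V n (p • x) ∈ U)
    {x : LaurentSeries k ⊗[k] V} (hx : x ∈ Submodule.span (PowerSeries k) S) :
    tensorCoeff k V n x ∈ U := by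
  suffices ∀ p : PowerSeries k, tensorCoeff k V n (p • x) ∈ U by simpa using this 1
  induction hx using Submodule.span_induction with
  | mem x hx => exact h x hx
  | zero => simp
  | add x y _ _ hx hy =>
    intro p
    rw [smul_add, map_add]
    exact U.add_mem (hx p) (hy p)
  | smul q x _ hx =>
    intro p
    rw [smul_smul]
    exact hx _

end TensorCoeff

/-- **Key step in Lemma 5.4 (waundersection).** For a decreasing exhaustive separated
filtration `F` of a finite-dimensional `k`-vector space `V` and a subspace `W ⊆ V`,
the Hodge–Pink lattice `q(F• ∩ W)` of the induced filtration equals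
`q(F•) ∩ (W ⊗_k k((t)))` inside `V ⊗_k k((t))` (realized as `k((t)) ⊗_k V`). -/
theorem statement9 (k : Type) [Field k] (V : Type) [AddCommGroup V] [Module k V]
    [FiniteDimensional k V]
    (F : ℤ → Submodule k V) (hdec : ∀ i : ℤ, F (i + 1) ≤ F i)
    (hexh : ∃ a : ℤ, ∀ i ≤ a, F i = ⊤) (hsep : ∃ b : ℤ, ∀ i ≥ b, F i = ⊥)
    (W : Submodule k V) :
    Submodule.span (PowerSeries k)
        (⋃ i : ℤ, {x : LaurentSeries k ⊗[k] V |
          ∃ v ∈ F i ⊓ W, x = (HahnSeries.single (-i) 1 : LaurentSeries k) ⊗ₜ[k] v}) =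
      Submodule.span (PowerSeries k)
          (⋃ i : ℤ, {x : LaurentSeries k ⊗[k] V |
            ∃ v ∈ F i, x = (HahnSeries.single (-i) 1 : LaurentSeries k) ⊗ₜ[k] v}) ⊓
        Submodule.span (PowerSeries k)
          {x : LaurentSeries k ⊗[k] V | ∃ c : LaurentSeries k, ∃ w ∈ W, x = c ⊗ₜ[k] w} := by
  obtain ⟨a, ha⟩ := hexh
  obtain ⟨b, hb⟩ := hsep
  apply le_antisymm
  · refine le_inf (Submodule.span_mono (Set.iUnion_mono fun i => ?_)) (Submodule.span_mono ?_)
    · rintro _ ⟨v, hv, rfl⟩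
      exact ⟨v, hv.1, rfl⟩
    · refine Set.iUnion_subset fun i => ?_
      rintro _ ⟨v, hv, rfl⟩
      exact ⟨_, v, hv.2, rfl⟩
  · rintro x ⟨hxF, hxW⟩
    refine mem_span_of_tensorCoeff_mem (fun i => F i ⊓ W) W (fun i => inf_le_right)
      (a := a) (b := b) (by simp [ha a le_rfl]) (fun i hi => by simp [hb i hi]) x
      fun n => ⟨tensorCoeff_mem_of_mem_span ?_ hxF, tensorCoeff_mem_of_mem_span ?_ hxW⟩
    · intro y hy p
      obtain ⟨i, v, hv, rfl⟩ := Set.mem_iUnion.1 hy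
      rw [TensorProduct.smul_tmul', tensorCoeff_tmul]
      rcases lt_or_ge n (-i) with hn | hn
      · simp [coeff_powerSeries_smul_single p hn]
      · exact Submodule.smul_mem _ _ (antitone_int_of_succ_le hdec (by omega : -n ≤ i) hv)
    · rintro _ ⟨c, w, hw, rfl⟩ p
      rw [TensorProduct.smul_tmul', tensorCoeff_tmul]
      exact W.smul_mem _ hw
end
end
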